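/- Let d ≥ 1 and α ∈ (0,2). Define ψ₀(ζ) := ∫_{|y|≤1} (1 − cos(ζ·y)) |y|^{−d−α} dy for ζ ∈ ℝ^d, φ(ξ,η) := ∫_0^1 ψ₀(sξ + η) ds, and q(z) := (2π)^{−2d} ∫_{ℝ^{2d}} cos(w·z) e^{−φ(w)} dw for z ∈ ℝ^{2d} (the density of the small-jump part Z₁^{(0)} of the α-stable kinetic process). Then there exist constants δ₀, δ₁, C₀, C₁ > 0, depending only on d and α, such that for all z ∈ ℝ^{2d}: C₀ · exp(−δ₀ (|z|+2) log(|z|+2)) ≤ q(z) ≤ C₁ · exp(−δ₁ (|z|+2) log(|z|+2)). -/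

import Mathlib

open MeasureTheory Real RealInnerProductSpace

/-- `ψ₀(ζ) = ∫_{|y|≤1} (1 − cos⟨ζ,y⟩)|y|^{−d−α} dy`. -/
noncomputable def psi0 (d : ℕ) (α : ℝ) (ζ : EuclideanSpace ℝ (Fin d)) : ℝ :=
  ∫ y in {y : EuclideanSpace ℝ (Fin d) | ‖y‖ ≤ 1},
    (1 - Real.cos ⟪ζ, y⟫) * ‖y‖ ^ (-(d : ℝ) - α)

/-- `φ(ξ,η) = ∫_0^1 ψ₀(sξ + η) ds`. -/
noncomputable def phi0 (d : ℕ) (α : ℝ)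
    (w : EuclideanSpace ℝ (Fin d) × EuclideanSpace ℝ (Fin d)) : ℝ :=
  ∫ s in (0 : ℝ)..1, psi0 d α (s • w.1 + w.2)

/-- The density `q` of the small-jump part `Z₁^{(0)}` of the α-stable kinetic process. -/
noncomputable def qker (d : ℕ) (α : ℝ)
    (z : EuclideanSpace ℝ (Fin d) × EuclideanSpace ℝ (Fin d)) : ℝ :=
  (2 * π) ^ (-(2 * (d : ℝ))) *
    ∫ w : EuclideanSpace ℝ (Fin d) × EuclideanSpace ℝ (Fin d),
      Real.cos (⟪w.1, z.1⟫ + ⟪w.2, z.2⟫) * Real.exp (-(phi0 d α w))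

section KineticExponent

open Set Metric Module

variable {E : Type*} [NormedAddCommGroup E] [InnerProductSpace ℝ E]

/-- The Euclidean pairing on `E × E`. -/
noncomputable def pairing (w z : E × E) : ℝ := ⟪w.1, z.1⟫ + ⟪w.2, z.2⟫

/-- The jump of the kinetic process caused by a velocity jump `y` at remaining time `s`. -/
def kineticJump (p : ℝ × E) : E × E := (p.1 • p.2, p.2)

theorem pairing_add_left (v w z : E × E) : pairing (v + w) z = pairing v z + pairing w z := by
  simp only [pairing, Prod.fst_add, Prod.snd_add, inner_add_left]; ring

theorem pairing_add_right (w y z : E × E) : pairing w (y + z) = pairing w y + pairing w z := by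
  simp only [pairing, Prod.fst_add, Prod.snd_add, inner_add_right]; ring

theorem pairing_sub_right (w y z : E × E) : pairing w (y - z) = pairing w y - pairing w z := by
  simp only [pairing, Prod.fst_sub, Prod.snd_sub, inner_sub_right]; ring

theorem pairing_smul_left (t : ℝ) (w z : E × E) : pairing (t • w) z = t * pairing w z := by
  simp only [pairing, Prod.smul_fst, Prod.smul_snd, real_inner_smul_left]; ring

theorem continuous_pairing : Continuous fun x : (E × E) × (E × E) => pairing x.1 x.2 := by
  unfold pairing; fun_prop

@[fun_prop]
theorem Continuous.pairing {X : Type*} [TopologicalSpace X] {f g : X → E × E}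
    (hf : Continuous f) (hg : Continuous g) : Continuous fun x => pairing (f x) (g x) :=
  continuous_pairing.comp (hf.prodMk hg)

@[fun_prop]
theorem continuous_kineticJump : Continuous (kineticJump : ℝ × E → E × E) := by
  unfold kineticJump; fun_prop

theorem pairing_kineticJump (w : E × E) (p : ℝ × E) :
    pairing w (kineticJump p) = ⟪p.1 • w.1 + w.2, p.2⟫ := by
  simp [pairing, kineticJump, inner_add_left, real_inner_smul_left, real_inner_smul_right]

theorem abs_pairing_le (w z : E × E) : |pairing w z| ≤ 2 * (‖w‖ * ‖z‖) := by
  have h1 := abs_real_inner_le_norm w.1 z.1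
  have h2 := abs_real_inner_le_norm w.2 z.2
  have h3 : ‖w.1‖ * ‖z.1‖ ≤ ‖w‖ * ‖z‖ :=
    mul_le_mul (norm_fst_le w) (norm_fst_le z) (norm_nonneg _) (norm_nonneg _)
  have h4 : ‖w.2‖ * ‖z.2‖ ≤ ‖w‖ * ‖z‖ :=
    mul_le_mul (norm_snd_le w) (norm_snd_le z) (norm_nonneg _) (norm_nonneg _)
  have h5 := abs_add_le ⟪w.1, z.1⟫ ⟪w.2, z.2⟫
  unfold pairing
  linarith

theorem norm_kineticJump {p : ℝ × E} (hp : p.1 ∈ Ioc (0 : ℝ) 1) :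
    ‖kineticJump p‖ = ‖p.2‖ := by
  rw [kineticJump, Prod.norm_mk, norm_smul, Real.norm_of_nonneg hp.1.le]
  exact max_eq_right (mul_le_of_le_one_left (norm_nonneg _) hp.2)

/-- The density of the truncated `α`-stable Lévy measure. -/
noncomputable def jumpRate (α : ℝ) (y : E) : ℝ := ‖y‖ ^ (-(finrank ℝ E : ℝ) - α)

theorem jumpRate_nonneg (α : ℝ) (y : E) : 0 ≤ jumpRate α y := by
  unfold jumpRate; positivity

variable [MeasurableSpace E]

/-- Lebesgue measure on pairs (jump time, velocity jump), restricted to `(0, 1]` times the closed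
unit ball. -/
noncomputable def jumpMeasure (E : Type*) [NormedAddCommGroup E] [InnerProductSpace ℝ E]
    [MeasurableSpace E] [BorelSpace E] [FiniteDimensional ℝ E] : Measure (ℝ × E) :=
  (volume.restrict (Ioc (0 : ℝ) 1)).prod (volume.restrict (closedBall (0 : E) 1))

variable [BorelSpace E]

theorem measurable_jumpRate (α : ℝ) : Measurable (jumpRate α : E → ℝ) := by
  unfold jumpRate; fun_prop

variable [FiniteDimensional ℝ E]

instance isFiniteMeasure_jumpMeasure : IsFiniteMeasure (jumpMeasure E) := by
  have : IsFiniteMeasure (volume.restrict (closedBall (0 : E) 1)) :=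
    ⟨by simpa using measure_closedBall_lt_top⟩
  unfold jumpMeasure; infer_instance

theorem jumpMeasure_eq_restrict :
    jumpMeasure E = volume.restrict (Ioc (0 : ℝ) 1 ×ˢ closedBall (0 : E) 1) := by
  rw [jumpMeasure, Measure.prod_restrict, Measure.volume_eq_prod]

theorem ae_jumpMeasure : ∀ᵐ p ∂jumpMeasure E, p.1 ∈ Ioc (0 : ℝ) 1 ∧ ‖p.2‖ ≤ 1 := by
  rw [jumpMeasure_eq_restrict]
  filter_upwards [ae_restrict_mem (measurableSet_Ioc.prod measurableSet_closedBall)] with p hp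
  exact ⟨hp.1, by simpa using hp.2⟩

theorem integrableOn_sq_mul_jumpRate (hE : 1 ≤ finrank ℝ E) {α : ℝ} (hα : α < 2) :
    IntegrableOn (fun y : E => ‖y‖ ^ 2 * jumpRate α y) (closedBall 0 1) := by
  refine IntegrableOn.mono_set (t := ball 0 2) ?_ (closedBall_subset_ball (by norm_num))
  refine integrableOn_ball_of_norm_le_rpow hE (C := 1) (α := finrank ℝ E + α - 2) (by linarith)
    (.of_forall fun y => ?_) ?_
  · rw [Real.norm_of_nonneg (mul_nonneg (by positivity) (jumpRate_nonneg _ _)), one_mul]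
    rcases (norm_nonneg y).eq_or_lt with h | h
    · rw [← h]; simp only [ne_eq, OfNat.ofNat_ne_zero, not_false_eq_true, zero_pow, zero_mul]
      positivity
    · rw [jumpRate, ← Real.rpow_natCast, ← Real.rpow_add h]
      apply le_of_eq; congr 1; push_cast; ring
  · exact (((measurable_norm).pow_const 2).mul (measurable_jumpRate α)).aestronglyMeasurable

theorem integrable_sq_mul_jumpRate (hE : 1 ≤ finrank ℝ E) {α : ℝ} (hα : α < 2) :
    Integrable (fun p : ℝ × E => ‖p.2‖ ^ 2 * jumpRate α p.2) (jumpMeasure E) :=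
  Integrable.comp_snd (integrableOn_sq_mul_jumpRate hE hα) _

theorem one_sub_cos_le_sq (t : ℝ) : 1 - Real.cos t ≤ t ^ 2 := by
  nlinarith [Real.one_sub_sq_div_two_le_cos (x := t), sq_nonneg t]

theorem integrable_one_sub_cos_mul_jumpRate (hE : 1 ≤ finrank ℝ E) {α : ℝ} (hα : α < 2)
    (w : E × E) :
    Integrable (fun p => (1 - Real.cos (pairing w (kineticJump p))) * jumpRate α p.2)
      (jumpMeasure E) := by
  refine ((integrable_sq_mul_jumpRate hE hα).const_mul (4 * ‖w‖ ^ 2)).mono' ?_ ?_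
  · refine (Measurable.mul ?_ ((measurable_jumpRate α).comp measurable_snd)).aestronglyMeasurable
    exact Continuous.measurable (by fun_prop)
  · filter_upwards [ae_jumpMeasure] with p hp
    have h1 := Real.cos_le_one (pairing w (kineticJump p))
    rw [Real.norm_of_nonneg (mul_nonneg (by linarith) (jumpRate_nonneg _ _)), ← mul_assoc]
    refine mul_le_mul_of_nonneg_right ?_ (jumpRate_nonneg _ _)
    refine (one_sub_cos_le_sq _).trans ?_
    rw [← sq_abs]
    have h2 := abs_pairing_le w (kineticJump p)
    rw [norm_kineticJump hp.1] at h2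
    calc _ ≤ (2 * (‖w‖ * ‖p.2‖)) ^ 2 := by gcongr
      _ = _ := by ring

/-- The characteristic exponent of the small-jump part of the kinetic process. -/
noncomputable def kineticExponent (α : ℝ) (w : E × E) : ℝ :=
  ∫ p, (1 - Real.cos (pairing w (kineticJump p))) * jumpRate α p.2 ∂jumpMeasure E

theorem measurable_kineticExponent (α : ℝ) : Measurable (kineticExponent (E := E) α) := by
  unfold kineticExponent
  refine (StronglyMeasurable.integral_prod_right ?_).measurable
  refine (Measurable.mul ?_ ?_).stronglyMeasurable
  · exact Continuous.measurable (by fun_prop)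
  · exact (measurable_jumpRate α).comp (measurable_snd.comp measurable_snd)

/-- The characteristic exponent of the truncated stable law. -/
noncomputable def stableExponent (α : ℝ) (ζ : E) : ℝ :=
  ∫ y in closedBall (0 : E) 1, (1 - Real.cos ⟪ζ, y⟫) * jumpRate α y

theorem integrableOn_one_sub_cos_mul_jumpRate (hE : 1 ≤ finrank ℝ E) {α : ℝ} (hα : α < 2)
    (ζ : E) :
    IntegrableOn (fun y => (1 - Real.cos ⟪ζ, y⟫) * jumpRate α y) (closedBall 0 1) := by
  refine ((integrableOn_sq_mul_jumpRate hE hα).const_mul (‖ζ‖ ^ 2)).mono' ?_ (.of_forall fun y => ?_)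
  · refine (Measurable.mul ?_ (measurable_jumpRate α)).aestronglyMeasurable
    exact Continuous.measurable (by fun_prop)
  · have h1 := Real.cos_le_one ⟪ζ, y⟫
    rw [Real.norm_of_nonneg (mul_nonneg (by linarith) (jumpRate_nonneg _ _)), ← mul_assoc]
    refine mul_le_mul_of_nonneg_right ?_ (jumpRate_nonneg _ _)
    refine (one_sub_cos_le_sq _).trans ?_
    rw [← sq_abs, ← mul_pow]
    gcongr
    exact abs_real_inner_le_norm _ _

theorem stableExponent_nonneg (α : ℝ) (ζ : E) : 0 ≤ stableExponent α ζ :=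
  integral_nonneg fun y => mul_nonneg (by linarith [Real.cos_le_one ⟪ζ, y⟫]) (jumpRate_nonneg _ _)

theorem kineticExponent_eq_integral (hE : 1 ≤ finrank ℝ E) {α : ℝ} (hα : α < 2) (w : E × E) :
    kineticExponent α w = ∫ s in Ioc (0 : ℝ) 1, stableExponent α (s • w.1 + w.2) := by
  rw [kineticExponent, jumpMeasure, integral_prod _ (integrable_one_sub_cos_mul_jumpRate hE hα w)]
  simp only [pairing_kineticJump, stableExponent]

theorem integrableOn_stableExponent (hE : 1 ≤ finrank ℝ E) {α : ℝ} (hα : α < 2) (w : E × E) :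
    IntegrableOn (fun s : ℝ => stableExponent α (s • w.1 + w.2)) (Ioc 0 1) := by
  have := (integrable_one_sub_cos_mul_jumpRate hE hα w).integral_prod_left
  simpa only [pairing_kineticJump, stableExponent, IntegrableOn] using this

theorem exists_stableExponent_ge (hE : 1 ≤ finrank ℝ E) {α : ℝ} (h0 : 0 < α) (hα : α < 2) :
    ∃ c > 0, ∀ ζ : E, c * (‖ζ‖ ^ α - 1) ≤ stableExponent α ζ := by
  have : Nontrivial E := Module.nontrivial_of_finrank_pos (R := ℝ) (by omega)
  have hcos : 0 < 1 - Real.cos (1 / 4) := by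
    have := Real.cos_lt_cos_of_nonneg_of_le_pi le_rfl (by linarith [Real.pi_gt_three])
      (show (0 : ℝ) < 1 / 4 by norm_num)
    rw [Real.cos_zero] at this; linarith
  have hv : 0 < volume.real (ball (0 : E) 1) :=
    ENNReal.toReal_pos (measure_ball_pos _ _ one_pos).ne' measure_ball_lt_top.ne
  refine ⟨(1 - Real.cos (1 / 4)) * ((1 / 4) ^ finrank ℝ E * volume.real (ball (0 : E) 1)),
    by positivity, fun ζ => ?_⟩
  rcases lt_or_ge ‖ζ‖ 1 with hζ | hζ
  · refine le_trans ?_ (stableExponent_nonneg α ζ)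
    refine mul_nonpos_of_nonneg_of_nonpos (by positivity) ?_
    linarith [Real.rpow_le_one (norm_nonneg ζ) hζ.le h0.le]
  set R := ‖ζ‖ with hR
  have hR0 : 0 < R := by linarith
  set y₀ : E := (1 / (2 * R ^ 2)) • ζ with hy₀
  have hy₀n : ‖y₀‖ = 1 / (2 * R) := by
    rw [hy₀, norm_smul, Real.norm_of_nonneg (by positivity), ← hR]; field_simp
  have hin : ⟪ζ, y₀⟫ = 1 / 2 := by
    rw [hy₀, real_inner_smul_right, real_inner_self_eq_norm_sq, ← hR]; field_simp
  have key : ∀ y ∈ ball y₀ (1 / (4 * R)), ‖y‖ ≤ 1 / R ∧ 1 / 4 ≤ ⟪ζ, y⟫ ∧ ⟪ζ, y⟫ ≤ 3 / 4 := by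
    intro y hy
    rw [mem_ball_iff_norm] at hy
    have h1 : ‖y‖ ≤ ‖y₀‖ + ‖y - y₀‖ := by simpa using norm_add_le y₀ (y - y₀)
    have h2 : |⟪ζ, y - y₀⟫| ≤ R * (1 / (4 * R)) :=
      (abs_real_inner_le_norm _ _).trans (by gcongr)
    have h3 : R * (1 / (4 * R)) = 1 / 4 := by field_simp
    rw [h3, inner_sub_right, hin, abs_le] at h2
    refine ⟨?_, by linarith, by linarith⟩
    have h4 : 1 / (2 * R) + 1 / (4 * R) ≤ 1 / R := by
      have : 1 / (2 * R) + 1 / (4 * R) = 3 / 4 * (1 / R) := by field_simp; norm_num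
      have : 0 < 1 / R := by positivity
      linarith
    linarith
  have hsub : ball y₀ (1 / (4 * R)) ⊆ closedBall 0 1 := fun y hy => by
    have : 1 / R ≤ 1 := by rw [div_le_one hR0]; exact hζ
    simpa using (key y hy).1.trans this
  have hint := integrableOn_one_sub_cos_mul_jumpRate hE hα ζ
  calc _ ≤ (1 - Real.cos (1 / 4)) * ((1 / 4) ^ finrank ℝ E * volume.real (ball (0 : E) 1))
          * R ^ α := by gcongr; linarith
    _ = ∫ y in ball y₀ (1 / (4 * R)), (1 - Real.cos (1 / 4)) * R ^ (finrank ℝ E + α) := by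
      have hvol : volume.real (ball y₀ (1 / (4 * R))) =
          (1 / (4 * R)) ^ finrank ℝ E * volume.real (ball (0 : E) 1) := by
        rw [Measure.real, Measure.addHaar_ball _ _ (by positivity),
          ENNReal.toReal_mul, ENNReal.toReal_ofReal (by positivity), ← Measure.real]
      rw [setIntegral_const, hvol, smul_eq_mul, Real.rpow_add hR0, Real.rpow_natCast]
      have : (1 / (4 * R)) ^ finrank ℝ E = (1 / 4) ^ finrank ℝ E / R ^ finrank ℝ E := by
        rw [← div_pow]; congr 1; field_simp
      rw [this]; field_simp
    _ ≤ ∫ y in ball y₀ (1 / (4 * R)), (1 - Real.cos ⟪ζ, y⟫) * jumpRate α y := by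
      refine setIntegral_mono_on ?_ (hint.mono_set hsub) measurableSet_ball fun y hy => ?_
      · exact integrableOn_const measure_ball_lt_top.ne
      obtain ⟨h1, h2, h3⟩ := key y hy
      refine mul_le_mul ?_ ?_ (by positivity) (by linarith [Real.cos_le_one ⟪ζ, y⟫])
      · linarith [Real.cos_le_cos_of_nonneg_of_le_pi (by norm_num)
          (by linarith [Real.pi_gt_three]) h2]
      · have hy0 : 0 < ‖y‖ := by
          rw [norm_pos_iff]; rintro rfl; simp at h2; linarith
        rw [jumpRate, show -(finrank ℝ E : ℝ) - α = -(finrank ℝ E + α) by ring,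
          Real.rpow_neg hy0.le, ← Real.inv_rpow hy0.le]
        refine Real.rpow_le_rpow hR0.le ?_ (by positivity)
        rw [le_inv_comm₀ hR0 hy0]; simpa using h1
    _ ≤ stableExponent α ζ := by
      refine setIntegral_mono_set hint (.of_forall fun y => ?_) hsub.eventuallyLE
      exact mul_nonneg (by linarith [Real.cos_le_one ⟪ζ, y⟫]) (jumpRate_nonneg _ _)

end KineticExponent

section KineticExponentGrowth

open Set Metric Module

variable {E : Type*} [NormedAddCommGroup E] [InnerProductSpace ℝ E]

theorem norm_div_four_rpow_le {α : ℝ} (h0 : 0 < α) (w : E × E) {s : ℝ}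
    (hs : s ∈ Icc (0 : ℝ) (1 / 2)) :
    (‖w‖ / 4) ^ α ≤ ‖s • w.1 + w.2‖ ^ α + ‖(s + 1 / 2) • w.1 + w.2‖ ^ α := by
  set a := s • w.1 + w.2 with ha
  set b := (s + 1 / 2) • w.1 + w.2 with hb
  have h1 : w.1 = (2 : ℝ) • (b - a) := by rw [ha, hb]; module
  have h2 : w.2 = (1 + 2 * s) • a - (2 * s) • b := by rw [ha, hb]; module
  have n1 : ‖w.1‖ ≤ 2 * (‖a‖ + ‖b‖) := by
    rw [h1, norm_smul, Real.norm_of_nonneg (by norm_num : (0 : ℝ) ≤ 2)]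
    linarith [norm_sub_le b a]
  have n2 : ‖w.2‖ ≤ 2 * (‖a‖ + ‖b‖) := by
    rw [h2]
    refine (norm_sub_le _ _).trans ?_
    rw [norm_smul, norm_smul, Real.norm_of_nonneg (by linarith [hs.1]),
      Real.norm_of_nonneg (by linarith [hs.1])]
    nlinarith [norm_nonneg a, norm_nonneg b, hs.1, hs.2]
  have n3 : ‖w‖ ≤ 2 * (‖a‖ + ‖b‖) := by rw [Prod.norm_def]; exact max_le n1 n2
  have pa : 0 ≤ ‖a‖ ^ α := by positivity
  have pb : 0 ≤ ‖b‖ ^ α := by positivity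
  rcases le_total ‖a‖ ‖b‖ with h | h
  · have : (‖w‖ / 4) ^ α ≤ ‖b‖ ^ α :=
      Real.rpow_le_rpow (by positivity) (by linarith) h0.le
    linarith
  · have : (‖w‖ / 4) ^ α ≤ ‖a‖ ^ α :=
      Real.rpow_le_rpow (by positivity) (by linarith) h0.le
    linarith

variable [MeasurableSpace E] [BorelSpace E] [FiniteDimensional ℝ E]

theorem exists_kineticExponent_ge (hE : 1 ≤ finrank ℝ E) {α : ℝ} (h0 : 0 < α) (hα : α < 2) :
    ∃ c > 0, ∃ C : ℝ, ∀ w : E × E, c * ‖w‖ ^ α - C ≤ kineticExponent α w := by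
  obtain ⟨c, hc, H⟩ := exists_stableExponent_ge (E := E) hE h0 hα
  refine ⟨c * (1 / 4) ^ α / 2, by positivity, c, fun w => ?_⟩
  set f : ℝ → ℝ := fun s => stableExponent α (s • w.1 + w.2) with hf
  have hint : IntervalIntegrable f volume 0 1 :=
    (intervalIntegrable_iff_integrableOn_Ioc_of_le zero_le_one).2
      (integrableOn_stableExponent hE hα w)
  have i1 : IntervalIntegrable f volume 0 (1 / 2) :=
    hint.mono_set (by rw [uIcc_of_le, uIcc_of_le] <;> norm_num
                      exact Icc_subset_Icc le_rfl (by norm_num))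
  have i2 : IntervalIntegrable f volume (1 / 2) 1 :=
    hint.mono_set (by rw [uIcc_of_le, uIcc_of_le] <;> norm_num
                      exact Icc_subset_Icc (by norm_num) le_rfl)
  have i3 : IntervalIntegrable (fun s => f (s + 1 / 2)) volume 0 (1 / 2) := by
    have := i2.comp_add_right (1 / 2)
    norm_num at this ⊢; exact this
  have e2 : ∫ s in (0 : ℝ)..(1 / 2), f (s + 1 / 2) = ∫ s in (1 / 2 : ℝ)..1, f s := by
    rw [intervalIntegral.integral_comp_add_right]; norm_num
  rw [kineticExponent_eq_integral hE hα, ← intervalIntegral.integral_of_le zero_le_one]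
  change _ ≤ ∫ s in (0 : ℝ)..1, f s
  rw [← intervalIntegral.integral_add_adjacent_intervals i1 i2, ← e2,
    ← intervalIntegral.integral_add i1 i3]
  have : ∫ _ in (0 : ℝ)..(1 / 2), c * ((‖w‖ / 4) ^ α - 2) ≤
      ∫ s in (0 : ℝ)..(1 / 2), (f s + f (s + 1 / 2)) := by
    refine intervalIntegral.integral_mono_on (by norm_num) (by simp) (i1.add i3) fun s hs => ?_
    have h1 := H (s • w.1 + w.2)
    have h2 := H ((s + 1 / 2) • w.1 + w.2)
    have h3 := mul_le_mul_of_nonneg_left (norm_div_four_rpow_le h0 w hs) hc.le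
    simp only [hf]
    nlinarith
  refine le_trans (le_of_eq ?_) this
  rw [intervalIntegral.integral_const, div_eq_mul_one_div ‖w‖, Real.mul_rpow (norm_nonneg _) (by norm_num),
    smul_eq_mul]
  ring

instance isAddHaarMeasure_volume_prod : (volume : Measure (E × E)).IsAddHaarMeasure := by
  rw [Measure.volume_eq_prod]; infer_instance

theorem integrable_norm_pow_mul_exp_neg_kineticExponent (hE : 1 ≤ finrank ℝ E) {α : ℝ}
    (h0 : 0 < α) (hα : α < 2) (k : ℕ) {a : ℝ} (ha : 0 < a) :
    Integrable (fun w : E × E => ‖w‖ ^ k * Real.exp (-(a * kineticExponent α w))) := by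
  have : Nontrivial E := Module.nontrivial_of_finrank_pos (R := ℝ) (by omega)
  obtain ⟨c, hc, C, H⟩ := exists_kineticExponent_ge (E := E) hE h0 hα
  have hdom : Integrable (fun w : E × E => ‖w‖ ^ k * Real.exp (-(a * c) * ‖w‖ ^ α)) := by
    rw [integrable_fun_norm_addHaar volume (f := fun t => t ^ k * Real.exp (-(a * c) * t ^ α))]
    have := integrableOn_rpow_mul_exp_neg_mul_rpow (s := ((finrank ℝ (E × E) - 1 + k : ℕ) : ℝ))
      (by have : (0 : ℝ) ≤ ((finrank ℝ (E × E) - 1 + k : ℕ) : ℝ) := Nat.cast_nonneg _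
          linarith) h0 (mul_pos ha hc)
    refine this.congr_fun (fun x hx => ?_) measurableSet_Ioi
    simp only [Real.rpow_natCast, smul_eq_mul, pow_add, mul_assoc]
  refine (hdom.const_mul (Real.exp (a * C))).mono' ?_ (.of_forall fun w => ?_)
  · exact ((measurable_norm.pow_const k).mul
      (Real.measurable_exp.comp ((measurable_kineticExponent α).const_mul a).neg)).aestronglyMeasurable
  · rw [Real.norm_of_nonneg (by positivity), mul_left_comm, ← Real.exp_add]
    gcongr
    nlinarith [mul_le_mul_of_nonneg_left (H w) ha.le]

theorem integrable_exp_neg_kineticExponent (hE : 1 ≤ finrank ℝ E) {α : ℝ}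
    (h0 : 0 < α) (hα : α < 2) :
    Integrable (fun w : E × E => Real.exp (-kineticExponent α w)) := by
  simpa using integrable_norm_pow_mul_exp_neg_kineticExponent (E := E) hE h0 hα 0 one_pos

end KineticExponentGrowth

section ComplexExponent

open Set Metric Module

theorem norm_one_sub_cos_le (v : ℂ) : ‖1 - Complex.cos v‖ ≤ ‖v‖ ^ 2 * Real.exp ‖v‖ := by
  have h1 := Complex.norm_exp_sub_sum_le_norm_mul_exp (v * Complex.I) 2
  have h2 := Complex.norm_exp_sub_sum_le_norm_mul_exp (-v * Complex.I) 2
  have h3 : 1 - Complex.cos v =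
      -((Complex.exp (v * Complex.I) -
          ∑ m ∈ Finset.range 2, (v * Complex.I) ^ m / (m.factorial : ℂ)) +
        (Complex.exp (-v * Complex.I) -
          ∑ m ∈ Finset.range 2, (-v * Complex.I) ^ m / (m.factorial : ℂ))) / 2 := by
    simp [Complex.cos, Finset.sum_range_succ]; ring
  simp only [norm_mul, norm_neg, Complex.norm_I, mul_one] at h1 h2
  rw [h3, norm_div, norm_neg, RCLike.norm_ofNat]
  have := norm_add_le (Complex.exp (v * Complex.I) -
          ∑ m ∈ Finset.range 2, (v * Complex.I) ^ m / (m.factorial : ℂ)) (Complex.exp (-v * Complex.I) -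
          ∑ m ∈ Finset.range 2, (-v * Complex.I) ^ m / (m.factorial : ℂ))
  linarith

theorem norm_sin_le_mul_exp (u : ℂ) : ‖Complex.sin u‖ ≤ ‖u‖ * Real.exp ‖u‖ := by
  have h1 := Complex.norm_exp_sub_sum_le_norm_mul_exp (u * Complex.I) 1
  have h2 := Complex.norm_exp_sub_sum_le_norm_mul_exp (-u * Complex.I) 1
  have h3 : Complex.sin u = ((Complex.exp (-u * Complex.I) - 1) -
      (Complex.exp (u * Complex.I) - 1)) * Complex.I / 2 := by
    simp [Complex.sin]
  simp only [norm_mul, norm_neg, Complex.norm_I, mul_one, Finset.range_one, Finset.sum_singleton,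
    pow_zero, Nat.factorial_zero, Nat.cast_one, div_one, pow_one] at h1 h2
  rw [h3, norm_div, norm_mul, Complex.norm_I, mul_one, RCLike.norm_ofNat]
  have := norm_sub_le (Complex.exp (-u * Complex.I) - 1) (Complex.exp (u * Complex.I) - 1)
  linarith

theorem norm_cos_le_exp (u : ℂ) : ‖Complex.cos u‖ ≤ Real.exp ‖u‖ := by
  have h1 : ‖Complex.exp (u * Complex.I)‖ ≤ Real.exp ‖u‖ := by
    simpa using Complex.norm_exp_le_exp_norm (u * Complex.I)
  have h2 : ‖Complex.exp (-u * Complex.I)‖ ≤ Real.exp ‖u‖ := by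
    simpa using Complex.norm_exp_le_exp_norm (-u * Complex.I)
  rw [Complex.cos, norm_div, RCLike.norm_ofNat]
  have := norm_add_le (Complex.exp (u * Complex.I)) (Complex.exp (-u * Complex.I))
  linarith

theorem norm_sin_ofReal_add_le (a : ℝ) (u : ℂ) :
    ‖Complex.sin (a + u)‖ ≤ (|a| + ‖u‖) * Real.exp ‖u‖ := by
  rw [Complex.sin_add]
  refine (norm_add_le _ _).trans ?_
  rw [norm_mul, norm_mul, ← Complex.ofReal_sin, ← Complex.ofReal_cos, Complex.norm_real,
    Complex.norm_real, add_mul]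
  have h1 : ‖Real.sin a‖ ≤ |a| := Real.abs_sin_le_abs
  have h2 : ‖Real.cos a‖ ≤ 1 := Real.abs_cos_le_one a
  have h3 := norm_sin_le_mul_exp u
  have h4 := norm_cos_le_exp u
  refine add_le_add (mul_le_mul h1 h4 (norm_nonneg _) (abs_nonneg _)) ?_
  nlinarith [norm_nonneg (Complex.sin u)]

theorem one_sub_cos_add_le (x y : ℝ) :
    1 - Real.cos (x + y) ≤ 2 * (1 - Real.cos x) + 2 * (1 - Real.cos y) := by
  obtain ⟨a, rfl⟩ : ∃ a, x = 2 * a := ⟨x / 2, by ring⟩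
  obtain ⟨b, rfl⟩ : ∃ b, y = 2 * b := ⟨y / 2, by ring⟩
  rw [← mul_add, Real.cos_two_mul, Real.cos_two_mul, Real.cos_two_mul, Real.cos_sq', Real.cos_sq',
    Real.cos_sq', Real.sin_add]
  have h1 : Real.sin a ^ 2 * Real.cos b ^ 2 ≤ Real.sin a ^ 2 :=
    mul_le_of_le_one_right (sq_nonneg _) (Real.cos_sq_le_one b)
  have h2 : Real.cos a ^ 2 * Real.sin b ^ 2 ≤ Real.sin b ^ 2 :=
    mul_le_of_le_one_left (sq_nonneg _) (Real.cos_sq_le_one a)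
  nlinarith [sq_nonneg (Real.sin a * Real.cos b - Real.cos a * Real.sin b)]

theorem re_one_sub_cos_ge (a b : ℝ) (τ : ℂ) :
    (1 - Real.cos a) / 2 - 2 * (‖τ‖ * |b|) ^ 2 * Real.exp (‖τ‖ * |b|) ≤
      (1 - Complex.cos (a + τ * b)).re := by
  have hre : (1 - Complex.cos (a + τ * b)).re =
      1 - Real.cos (a + τ.re * b) * Real.cosh (τ.im * b) := by
    rw [Complex.cos_eq]
    have e1 : ((a : ℂ) + τ * b).re = a + τ.re * b := by simp
    have e2 : ((a : ℂ) + τ * b).im = τ.im * b := by simp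
    rw [e1, e2, ← Complex.ofReal_cos, ← Complex.ofReal_cosh, ← Complex.ofReal_sin,
      ← Complex.ofReal_sinh, ← Complex.ofReal_mul, ← Complex.ofReal_mul, Complex.sub_re,
      Complex.sub_re, Complex.one_re, Complex.ofReal_re, Complex.re_ofReal_mul, Complex.I_re]
    ring
  have hb1 : |τ.re * b| ≤ ‖τ‖ * |b| := by
    rw [abs_mul]; gcongr; exact Complex.abs_re_le_norm τ
  have hb2 : |τ.im * b| ≤ ‖τ‖ * |b| := by
    rw [abs_mul]; gcongr; exact Complex.abs_im_le_norm τ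
  have hcosh : Real.cosh (τ.im * b) - 1 ≤ (‖τ‖ * |b|) ^ 2 * Real.exp (‖τ‖ * |b|) := by
    have h := norm_one_sub_cos_le ((τ.im * b : ℝ) * Complex.I)
    rw [Complex.cos_mul_I, ← Complex.ofReal_cosh, ← Complex.ofReal_one, ← Complex.ofReal_sub,
      Complex.norm_real, norm_mul, Complex.norm_I, mul_one, Complex.norm_real, Real.norm_eq_abs,
      Real.norm_eq_abs] at h
    calc _ ≤ |1 - Real.cosh (τ.im * b)| := by rw [abs_sub_comm]; exact le_abs_self _
      _ ≤ _ := h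
      _ ≤ _ := by gcongr
  have hc1 := Real.one_le_cosh (τ.im * b)
  have hc2 := Real.cos_le_one (a + τ.re * b)
  have hsum := one_sub_cos_add_le (a + τ.re * b) (-(τ.re * b))
  rw [add_neg_cancel_right, Real.cos_neg] at hsum
  have hsq : 1 - Real.cos (τ.re * b) ≤ (‖τ‖ * |b|) ^ 2 * Real.exp (‖τ‖ * |b|) := by
    refine (one_sub_cos_le_sq _).trans ?_
    rw [← sq_abs]
    calc |τ.re * b| ^ 2 ≤ (‖τ‖ * |b|) ^ 2 := by gcongr
      _ ≤ _ := le_mul_of_one_le_right (by positivity) (Real.one_le_exp (by positivity))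
  rw [hre]
  nlinarith [mul_nonneg (sub_nonneg.2 hc1) (sub_nonneg.2 hc2)]

variable {E : Type*} [NormedAddCommGroup E] [InnerProductSpace ℝ E] [MeasurableSpace E]
  [BorelSpace E] [FiniteDimensional ℝ E]

theorem ae_abs_pairing_kineticJump_le (w : E × E) :
    ∀ᵐ p ∂jumpMeasure E, |pairing w (kineticJump p)| ≤ 2 * ‖w‖ * ‖p.2‖ ∧ ‖p.2‖ ≤ 1 := by
  filter_upwards [ae_jumpMeasure] with p hp
  have h := abs_pairing_le w (kineticJump p)
  rw [norm_kineticJump hp.1] at h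
  exact ⟨by linarith, hp.2⟩

/-- The extension of `t ↦ kineticExponent α (w + t • θ)` to complex `t`. -/
noncomputable def complexExponent (α : ℝ) (θ w : E × E) (τ : ℂ) : ℂ :=
  ∫ p, (1 - Complex.cos ((pairing w (kineticJump p) : ℝ) +
    τ * (pairing θ (kineticJump p) : ℝ))) * (jumpRate α p.2 : ℝ) ∂jumpMeasure E

/-- The derivative of `complexExponent` in the complex parameter. -/
noncomputable def complexExponentDeriv (α : ℝ) (θ w : E × E) (τ : ℂ) : ℂ :=
  ∫ p, Complex.sin ((pairing w (kineticJump p) : ℝ) + τ * (pairing θ (kineticJump p) : ℝ)) *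
    (pairing θ (kineticJump p) : ℝ) * (jumpRate α p.2 : ℝ) ∂jumpMeasure E

theorem complexExponent_ofReal (α : ℝ) (θ w : E × E) (t : ℝ) :
    complexExponent α θ w t = (kineticExponent α (w + t • θ) : ℝ) := by
  rw [complexExponent, kineticExponent, ← integral_complex_ofReal]
  congr 1 with p
  rw [pairing_add_left, pairing_smul_left]
  push_cast; rfl

theorem measurable_complexExponent (α : ℝ) (θ : E × E) (τ : ℂ) :
    Measurable fun w => complexExponent α θ w τ := by
  unfold complexExponent
  refine (StronglyMeasurable.integral_prod_right ?_).measurable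
  refine (Measurable.mul ?_ ?_).stronglyMeasurable
  · exact Continuous.measurable (by fun_prop)
  · exact Complex.measurable_ofReal.comp
      ((measurable_jumpRate α).comp (measurable_snd.comp measurable_snd))

theorem measurable_complexExponentDeriv (α : ℝ) (θ : E × E) (τ : ℂ) :
    Measurable fun w => complexExponentDeriv α θ w τ := by
  unfold complexExponentDeriv
  refine (StronglyMeasurable.integral_prod_right ?_).measurable
  refine (Measurable.mul ?_ ?_).stronglyMeasurable
  · exact Continuous.measurable (by fun_prop)
  · exact Complex.measurable_ofReal.comp
      ((measurable_jumpRate α).comp (measurable_snd.comp measurable_snd))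

theorem integrable_complexExponent (hE : 1 ≤ finrank ℝ E) {α : ℝ} (hα : α < 2) (θ w : E × E)
    (τ : ℂ) :
    Integrable (fun p => (1 - Complex.cos ((pairing w (kineticJump p) : ℝ) +
      τ * (pairing θ (kineticJump p) : ℝ))) * (jumpRate α p.2 : ℝ)) (jumpMeasure E) := by
  set M := 2 * ‖w‖ + ‖τ‖ * (2 * ‖θ‖) with hM
  refine ((integrable_sq_mul_jumpRate hE hα).const_mul (M ^ 2 * Real.exp M)).mono' ?_ ?_
  · refine (Measurable.mul ?_ (Complex.measurable_ofReal.comp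
      ((measurable_jumpRate α).comp measurable_snd))).aestronglyMeasurable
    exact Continuous.measurable (by fun_prop)
  · filter_upwards [ae_abs_pairing_kineticJump_le w, ae_abs_pairing_kineticJump_le θ]
      with p hw hθ
    rw [norm_mul, Complex.norm_real, Real.norm_of_nonneg (jumpRate_nonneg _ _), ← mul_assoc]
    refine mul_le_mul_of_nonneg_right ?_ (jumpRate_nonneg _ _)
    refine (norm_one_sub_cos_le _).trans ?_
    have h1 : ‖((pairing w (kineticJump p) : ℝ) : ℂ) + τ * (pairing θ (kineticJump p) : ℝ)‖ ≤
        M * ‖p.2‖ := by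
      refine (norm_add_le _ _).trans ?_
      rw [norm_mul, Complex.norm_real, Complex.norm_real, Real.norm_eq_abs, Real.norm_eq_abs]
      have := mul_le_mul_of_nonneg_left hθ.1 (norm_nonneg τ)
      rw [hM, add_mul]
      linarith [hw.1]
    have hM0 : 0 ≤ M := by positivity
    have h2 : M * ‖p.2‖ ≤ M := mul_le_of_le_one_right hM0 hw.2
    calc _ ≤ (M * ‖p.2‖) ^ 2 * Real.exp M := by
          gcongr; exact h1.trans h2
      _ = _ := by ring

theorem exists_re_complexExponent_ge (hE : 1 ≤ finrank ℝ E) {α : ℝ} (hα : α < 2) :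
    ∃ K ≥ 0, ∀ (θ w : E × E) (τ : ℂ), kineticExponent α w / 2 -
      K * (‖τ‖ * ‖θ‖) ^ 2 * Real.exp (2 * (‖τ‖ * ‖θ‖)) ≤ (complexExponent α θ w τ).re := by
  set I := ∫ p, ‖p.2‖ ^ 2 * jumpRate α p.2 ∂jumpMeasure E with hI
  have hI0 : 0 ≤ I := integral_nonneg fun p => mul_nonneg (by positivity) (jumpRate_nonneg _ _)
  refine ⟨8 * I, by positivity, fun θ w τ => ?_⟩
  set s := ‖τ‖ * ‖θ‖ with hs
  have hs0 : 0 ≤ s := by positivity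
  have i1 := (integrable_one_sub_cos_mul_jumpRate hE hα w).div_const 2
  have i2 := (integrable_sq_mul_jumpRate (E := E) hE hα).const_mul (8 * s ^ 2 * Real.exp (2 * s))
  have i3 := integrable_complexExponent hE hα θ w τ
  have e : kineticExponent α w / 2 - 8 * I * s ^ 2 * Real.exp (2 * s) =
      ∫ p, ((1 - Real.cos (pairing w (kineticJump p))) * jumpRate α p.2 / 2 -
        8 * s ^ 2 * Real.exp (2 * s) * (‖p.2‖ ^ 2 * jumpRate α p.2)) ∂jumpMeasure E := by
    rw [integral_sub i1 i2, integral_div, integral_const_mul, ← hI, kineticExponent]; ring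
  have hre : (complexExponent α θ w τ).re = ∫ p, ((1 - Complex.cos ((pairing w (kineticJump p) : ℝ) +
      τ * (pairing θ (kineticJump p) : ℝ))) * (jumpRate α p.2 : ℝ)).re ∂jumpMeasure E := by
    rw [complexExponent]; exact (integral_re i3).symm
  rw [e, hre]
  refine integral_mono_ae (i1.sub i2) i3.re ?_
  filter_upwards [ae_abs_pairing_kineticJump_le θ] with p hθ
  have h1 := re_one_sub_cos_ge (pairing w (kineticJump p)) (pairing θ (kineticJump p)) τ
  have h2 : ‖τ‖ * |pairing θ (kineticJump p)| ≤ 2 * s * ‖p.2‖ := by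
    have := mul_le_mul_of_nonneg_left hθ.1 (norm_nonneg τ); rw [hs]; linarith
  have h3 : 2 * s * ‖p.2‖ ≤ 2 * s := mul_le_of_le_one_right (by positivity) hθ.2
  have h4 : 2 * (‖τ‖ * |pairing θ (kineticJump p)|) ^ 2 *
      Real.exp (‖τ‖ * |pairing θ (kineticJump p)|) ≤
        2 * (2 * s * ‖p.2‖) ^ 2 * Real.exp (2 * s) := by
    exact mul_le_mul (by gcongr) (Real.exp_le_exp.2 (h2.trans h3)) (by positivity) (by positivity)
  simp only [Complex.re_mul_ofReal]
  have h5 := mul_le_mul_of_nonneg_right h1 (jumpRate_nonneg α p.2)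
  have h6 := mul_le_mul_of_nonneg_right h4 (jumpRate_nonneg α p.2)
  linarith

theorem exists_complexExponentDeriv_bound (hE : 1 ≤ finrank ℝ E) {α : ℝ} (hα : α < 2) :
    ∃ K ≥ 0, ∀ (θ w : E × E) (τ : ℂ) (r : ℝ), ‖τ‖ < r →
      ‖complexExponentDeriv α θ w τ‖ ≤
        K * ((‖w‖ + r * ‖θ‖) * ‖θ‖ * Real.exp (2 * (r * ‖θ‖))) ∧
      HasDerivAt (complexExponent α θ w) (complexExponentDeriv α θ w τ) τ := by
  set I := ∫ p, ‖p.2‖ ^ 2 * jumpRate α p.2 ∂jumpMeasure E with hI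
  have hI0 : 0 ≤ I := integral_nonneg fun p => mul_nonneg (by positivity) (jumpRate_nonneg _ _)
  refine ⟨4 * I, by positivity, fun θ w τ r hτ => ?_⟩
  have hr : 0 < r := (norm_nonneg τ).trans_lt hτ
  set B := 4 * ((‖w‖ + r * ‖θ‖) * ‖θ‖ * Real.exp (2 * (r * ‖θ‖))) with hB
  have hbound : ∀ᵐ p ∂jumpMeasure E, ∀ σ ∈ ball (0 : ℂ) r,
      ‖Complex.sin ((pairing w (kineticJump p) : ℝ) + σ * (pairing θ (kineticJump p) : ℝ)) *
        (pairing θ (kineticJump p) : ℝ) * (jumpRate α p.2 : ℝ)‖ ≤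
        B * (‖p.2‖ ^ 2 * jumpRate α p.2) := by
    filter_upwards [ae_abs_pairing_kineticJump_le w, ae_abs_pairing_kineticJump_le θ]
      with p hw hθ σ hσ
    rw [mem_ball_zero_iff] at hσ
    rw [norm_mul, norm_mul, Complex.norm_real, Complex.norm_real,
      Real.norm_of_nonneg (jumpRate_nonneg _ _), ← mul_assoc, Real.norm_eq_abs]
    refine mul_le_mul_of_nonneg_right ?_ (jumpRate_nonneg _ _)
    have h1 := norm_sin_ofReal_add_le (pairing w (kineticJump p))
      (σ * (pairing θ (kineticJump p) : ℝ))
    rw [norm_mul, Complex.norm_real, Real.norm_eq_abs] at h1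
    have h2 : ‖σ‖ * |pairing θ (kineticJump p)| ≤ 2 * (r * ‖θ‖) * ‖p.2‖ := by
      calc _ ≤ r * (2 * ‖θ‖ * ‖p.2‖) := by gcongr; exact hθ.1
        _ = _ := by ring
    have h3 : 2 * (r * ‖θ‖) * ‖p.2‖ ≤ 2 * (r * ‖θ‖) :=
      mul_le_of_le_one_right (by positivity) hθ.2
    calc _ ≤ ((2 * ‖w‖ * ‖p.2‖ + 2 * (r * ‖θ‖) * ‖p.2‖) * Real.exp (2 * (r * ‖θ‖))) *
          (2 * ‖θ‖ * ‖p.2‖) := by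
          refine mul_le_mul (h1.trans ?_) hθ.1 (abs_nonneg _) (by positivity)
          exact mul_le_mul (add_le_add hw.1 h2) (Real.exp_le_exp.2 (h2.trans h3)) (by positivity)
            (by positivity)
      _ = _ := by rw [hB]; ring
  have hint := (integrable_sq_mul_jumpRate (E := E) hE hα).const_mul B
  have hder := hasDerivAt_integral_of_dominated_loc_of_deriv_le (μ := jumpMeasure E)
    (F := fun (σ : ℂ) p => (1 - Complex.cos ((pairing w (kineticJump p) : ℝ) +
      σ * (pairing θ (kineticJump p) : ℝ))) * ((jumpRate α p.2 : ℝ) : ℂ))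
    (F' := fun (σ : ℂ) p => Complex.sin ((pairing w (kineticJump p) : ℝ) +
      σ * (pairing θ (kineticJump p) : ℝ)) * (pairing θ (kineticJump p) : ℝ) *
        ((jumpRate α p.2 : ℝ) : ℂ))
    (x₀ := τ) (s := ball 0 r) (isOpen_ball.mem_nhds (by simpa using hτ))
    (.of_forall fun σ => (integrable_complexExponent hE hα θ w σ).aestronglyMeasurable)
    (integrable_complexExponent hE hα θ w τ) ?_ hbound hint ?_
  · refine ⟨?_, hder.2⟩
    refine (norm_integral_le_of_norm_le hint (hbound.mono fun p hp =>
      hp τ (by simpa using hτ))).trans (le_of_eq ?_)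
    rw [integral_const_mul, ← hI, hB]; ring
  · refine (Measurable.mul ?_ (Complex.measurable_ofReal.comp
      ((measurable_jumpRate α).comp measurable_snd))).aestronglyMeasurable
    exact Continuous.measurable (by fun_prop)
  · refine .of_forall fun p σ _ => ?_
    have h1 : HasDerivAt (fun σ : ℂ => ((pairing w (kineticJump p) : ℝ) : ℂ) +
        σ * (pairing θ (kineticJump p) : ℝ)) ((pairing θ (kineticJump p) : ℝ) : ℂ) σ := by
      simpa using ((hasDerivAt_id σ).mul_const ((pairing θ (kineticJump p) : ℝ) : ℂ)).const_add
        ((pairing w (kineticJump p) : ℝ) : ℂ)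
    have h2 := ((h1.ccos.const_sub 1).mul_const ((jumpRate α p.2 : ℝ) : ℂ))
    exact h2.congr_deriv (by ring)

end ComplexExponent

section UpperBound

open Set Metric Module

variable {E : Type*} [NormedAddCommGroup E] [InnerProductSpace ℝ E] [MeasurableSpace E]
  [BorelSpace E] [FiniteDimensional ℝ E]

/-- The Fourier integrand of `exp (-kineticExponent α)` at `z`, translated by the complex multiple
`τ` of `θ`. -/
noncomputable def shiftedIntegrand (α : ℝ) (θ z w : E × E) (τ : ℂ) : ℂ :=
  Complex.exp (((pairing w z : ℝ) + τ * (pairing θ z : ℝ)) * Complex.I -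
    complexExponent α θ w τ)

theorem shiftedIntegrand_ofReal (α : ℝ) (θ z w : E × E) (t : ℝ) :
    shiftedIntegrand α θ z w t = Complex.exp ((pairing (w + t • θ) z : ℝ) * Complex.I) *
      (Real.exp (-kineticExponent α (w + t • θ)) : ℝ) := by
  rw [shiftedIntegrand, complexExponent_ofReal, sub_eq_add_neg, Complex.exp_add, pairing_add_left,
    pairing_smul_left]
  push_cast; rfl

theorem measurable_shiftedIntegrand (α : ℝ) (θ z : E × E) (τ : ℂ) :
    Measurable fun w => shiftedIntegrand α θ z w τ := by
  unfold shiftedIntegrand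
  refine Complex.measurable_exp.comp (Measurable.sub ?_ (measurable_complexExponent α θ τ))
  exact Continuous.measurable (by fun_prop)

theorem norm_shiftedIntegrand (α : ℝ) (θ z w : E × E) (τ : ℂ) :
    ‖shiftedIntegrand α θ z w τ‖ =
      Real.exp (-(τ.im * pairing θ z) - (complexExponent α θ w τ).re) := by
  rw [shiftedIntegrand, Complex.norm_exp]
  simp

theorem exists_norm_shiftedIntegrand_le (hE : 1 ≤ finrank ℝ E) {α : ℝ} (hα : α < 2) :
    ∃ K ≥ 0, ∀ (θ z w : E × E) (τ : ℂ), ‖shiftedIntegrand α θ z w τ‖ ≤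
      Real.exp (-(τ.im * pairing θ z) + K * (‖τ‖ * ‖θ‖) ^ 2 * Real.exp (2 * (‖τ‖ * ‖θ‖))) *
        Real.exp (-(1 / 2 * kineticExponent α w)) := by
  obtain ⟨K, hK, H⟩ := exists_re_complexExponent_ge (E := E) hE hα
  refine ⟨K, hK, fun θ z w τ => ?_⟩
  rw [norm_shiftedIntegrand, ← Real.exp_add]
  gcongr
  linarith [H θ w τ]

theorem integrable_shiftedIntegrand (hE : 1 ≤ finrank ℝ E) {α : ℝ} (h0 : 0 < α) (hα : α < 2)
    (θ z : E × E) (τ : ℂ) : Integrable fun w => shiftedIntegrand α θ z w τ := by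
  obtain ⟨K, -, H⟩ := exists_norm_shiftedIntegrand_le (E := E) hE hα
  have := integrable_norm_pow_mul_exp_neg_kineticExponent (E := E) hE h0 hα 0
    (a := 1 / 2) (by norm_num)
  simp only [pow_zero, one_mul] at this
  exact (this.const_mul _).mono' (measurable_shiftedIntegrand α θ z τ).aestronglyMeasurable
    (.of_forall fun w => H θ z w τ)

theorem differentiable_integral_shiftedIntegrand (hE : 1 ≤ finrank ℝ E) {α : ℝ} (h0 : 0 < α)
    (hα : α < 2) (θ z : E × E) :
    Differentiable ℂ fun τ => ∫ w, shiftedIntegrand α θ z w τ := by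
  intro τ
  obtain ⟨K, hK, H⟩ := exists_norm_shiftedIntegrand_le (E := E) hE hα
  obtain ⟨L, hL, HL⟩ := exists_complexExponentDeriv_bound (E := E) hE hα
  set r := ‖τ‖ + 1 with hr
  have hr0 : 0 < r := by positivity
  set A := Real.exp (r * |pairing θ z| + K * (r * ‖θ‖) ^ 2 * Real.exp (2 * (r * ‖θ‖))) with hA
  set D := ‖θ‖ * Real.exp (2 * (r * ‖θ‖)) with hD
  have I0 := integrable_norm_pow_mul_exp_neg_kineticExponent (E := E) hE h0 hα 0
    (a := 1 / 2) (by norm_num)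
  have I1 := integrable_norm_pow_mul_exp_neg_kineticExponent (E := E) hE h0 hα 1
    (a := 1 / 2) (by norm_num)
  have hint := (I0.const_mul (A * (|pairing θ z| + L * (r * ‖θ‖ * D)))).add
    (I1.const_mul (A * (L * D)))
  refine (hasDerivAt_integral_of_dominated_loc_of_deriv_le (μ := volume)
    (F := fun (σ : ℂ) w => shiftedIntegrand α θ z w σ)
    (F' := fun (σ : ℂ) w => shiftedIntegrand α θ z w σ *
      ((pairing θ z : ℝ) * Complex.I - complexExponentDeriv α θ w σ))
    (x₀ := τ) (s := ball 0 r) (isOpen_ball.mem_nhds (by simp [hr]))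
    (.of_forall fun σ => (measurable_shiftedIntegrand α θ z σ).aestronglyMeasurable)
    (integrable_shiftedIntegrand hE h0 hα θ z τ) ?_ (.of_forall fun w σ hσ => ?_) hint
    (.of_forall fun w σ hσ => ?_)).2.differentiableAt
  · exact ((measurable_shiftedIntegrand α θ z τ).mul
      (measurable_const.sub (measurable_complexExponentDeriv α θ τ))).aestronglyMeasurable
  · rw [mem_ball_zero_iff] at hσ
    have h1 := H θ z w σ
    have h2 := (HL θ w σ r hσ).1
    have h3 : ‖shiftedIntegrand α θ z w σ‖ ≤
        A * Real.exp (-(1 / 2 * kineticExponent α w)) := by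
      refine h1.trans (mul_le_mul_of_nonneg_right ?_ (Real.exp_pos _).le)
      rw [hA]
      refine Real.exp_le_exp.2 (add_le_add ?_ (by gcongr))
      calc -(σ.im * pairing θ z) ≤ |σ.im * pairing θ z| := neg_le_abs _
        _ ≤ _ := by rw [abs_mul]; gcongr; exact (Complex.abs_im_le_norm σ).trans hσ.le
    have h4 : ‖((pairing θ z : ℝ) : ℂ) * Complex.I - complexExponentDeriv α θ w σ‖ ≤
        |pairing θ z| + L * ((‖w‖ + r * ‖θ‖) * D) := by
      refine (norm_sub_le _ _).trans ?_
      rw [norm_mul, Complex.norm_I, mul_one, Complex.norm_real, Real.norm_eq_abs]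
      refine add_le_add_right (h2.trans (le_of_eq ?_)) _
      rw [hD]; ring
    rw [norm_mul]
    calc _ ≤ (A * Real.exp (-(1 / 2 * kineticExponent α w))) *
          (|pairing θ z| + L * ((‖w‖ + r * ‖θ‖) * D)) := by gcongr
      _ = _ := by simp only [Pi.add_apply, pow_zero, pow_one]; ring
  · rw [mem_ball_zero_iff] at hσ
    have h1 : HasDerivAt (fun σ : ℂ => (((pairing w z : ℝ) : ℂ) + σ * (pairing θ z : ℝ)) *
        Complex.I) (((pairing θ z : ℝ) : ℂ) * Complex.I) σ := by
      simpa using (((hasDerivAt_id σ).mul_const ((pairing θ z : ℝ) : ℂ)).const_add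
        ((pairing w z : ℝ) : ℂ)).mul_const Complex.I
    exact (h1.sub (HL θ w σ r hσ).2).cexp

theorem integral_shiftedIntegrand_eq (hE : 1 ≤ finrank ℝ E) {α : ℝ} (h0 : 0 < α)
    (hα : α < 2) (θ z : E × E) (τ : ℂ) :
    ∫ w, shiftedIntegrand α θ z w τ = ∫ w, shiftedIntegrand α θ z w 0 := by
  have hreal : ∀ t : ℝ, ∫ w, shiftedIntegrand α θ z w t = ∫ w, shiftedIntegrand α θ z w 0 := by
    intro t
    have h := shiftedIntegrand_ofReal α θ z
    have h' := fun w => h w 0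
    simp only [zero_smul, add_zero, Complex.ofReal_zero] at h'
    simp only [h, h']
    exact integral_add_right_eq_self (μ := volume) (fun w : E × E =>
      Complex.exp ((pairing w z : ℝ) * Complex.I) * (Real.exp (-kineticExponent α w) : ℝ)) (t • θ)
  have han : AnalyticOnNhd ℂ (fun τ => ∫ w, shiftedIntegrand α θ z w τ) univ := fun σ _ =>
    (differentiable_integral_shiftedIntegrand hE h0 hα θ z).analyticAt σ
  have heq := han.eq_of_frequently_eq (g := fun _ => ∫ w, shiftedIntegrand α θ z w 0)
    (fun σ _ => analyticAt_const) (z₀ := 0) ?_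
  · exact congrFun heq τ
  have hu : Filter.Tendsto (fun n : ℕ => ((1 / ((n : ℝ) + 1) : ℝ) : ℂ)) Filter.atTop
      (nhdsWithin 0 {0}ᶜ) := by
    refine tendsto_nhdsWithin_iff.2 ⟨?_, .of_forall fun n => ?_⟩
    · simpa [Function.comp_def] using (Complex.continuous_ofReal.tendsto 0).comp
        (tendsto_one_div_add_atTop_nhds_zero_nat (𝕜 := ℝ))
    · have : (1 / ((n : ℝ) + 1) : ℝ) ≠ 0 := by positivity
      simpa only [mem_compl_iff, mem_singleton_iff, Complex.ofReal_eq_zero] using this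
  exact hu.frequently (Filter.Frequently.of_forall fun n => hreal _)

/-- The cosine transform with respect to `pairing`. -/
noncomputable def cosTransform (h : E × E → ℝ) (z : E × E) : ℝ :=
  ∫ w, Real.cos (pairing w z) * h w

theorem exists_cosTransform_le_exp (hE : 1 ≤ finrank ℝ E) {α : ℝ} (h0 : 0 < α) (hα : α < 2) :
    ∃ C ≥ 0, ∃ K ≥ 0, ∀ θ z : E × E,
      cosTransform (fun w => Real.exp (-kineticExponent α w)) z ≤
        C * Real.exp (-pairing θ z + K * ‖θ‖ ^ 2 * Real.exp (2 * ‖θ‖)) := by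
  obtain ⟨K, hK, H⟩ := exists_norm_shiftedIntegrand_le (E := E) hE hα
  have I0 := integrable_norm_pow_mul_exp_neg_kineticExponent (E := E) hE h0 hα 0
    (a := 1 / 2) (by norm_num)
  simp only [pow_zero, one_mul] at I0
  refine ⟨∫ w : E × E, Real.exp (-(1 / 2 * kineticExponent α w)),
    integral_nonneg fun w => (Real.exp_pos _).le, K, hK, fun θ z => ?_⟩
  have hre : cosTransform (fun w => Real.exp (-kineticExponent α w)) z =
      (∫ w, shiftedIntegrand α θ z w 0).re := by
    rw [← RCLike.re_eq_complex_re, ← integral_re (integrable_shiftedIntegrand hE h0 hα θ z 0)]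
    unfold cosTransform
    congr 1 with w
    have := shiftedIntegrand_ofReal α θ z w 0
    simp only [zero_smul, add_zero, Complex.ofReal_zero] at this
    rw [this, RCLike.re_eq_complex_re, Complex.re_mul_ofReal, Complex.exp_ofReal_mul_I_re]
  rw [hre, ← integral_shiftedIntegrand_eq hE h0 hα θ z Complex.I]
  refine (Complex.re_le_norm _).trans ?_
  rw [mul_comm, ← integral_const_mul]
  refine norm_integral_le_of_norm_le (I0.const_mul _) (.of_forall fun w => ?_)
  simpa using H θ z w Complex.I

/-- A choice of exponential tilt turns the Chernoff bound into superexponential decay. -/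
theorem exists_tilt_bound {K : ℝ} (hK : 0 ≤ K) :
    ∃ C : ℝ, ∀ x : ℝ, 0 ≤ x → ∀ a : ℝ, a = Real.log (x + 2) / 8 →
      -(a * x) + K * a ^ 2 * Real.exp (2 * a) ≤
        C - (1 / 16) * (x + 2) * Real.log (x + 2) := by
  set B := 32 * (K / 4 + 1) with hB
  refine ⟨(K / 4 + 1) * B ^ 3, fun x hx a ha => ?_⟩
  set u := Real.exp (2 * a) with hu
  have hR : 0 < x + 2 := by linarith
  have hu4 : u ^ 4 = x + 2 := by
    rw [hu, ← Real.exp_nat_mul, ha]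
    convert Real.exp_log hR using 2
    push_cast; ring
  have hlog2 : 1 / 2 ≤ 8 * a := by
    have h1 := Real.log_two_gt_d9
    have h2 := Real.log_le_log two_pos (show (2 : ℝ) ≤ x + 2 by linarith)
    rw [ha]; linarith
  have hau : 2 * a ≤ u := by linarith [Real.add_one_le_exp (2 * a)]
  have hu1 : 1 ≤ u := Real.one_le_exp (by linarith)
  have hx2 : x = u ^ 4 - 2 := by linarith
  have hlog : Real.log (x + 2) = 8 * a := by rw [ha]; ring
  have h1 : K * a ^ 2 * u ≤ K / 4 * u ^ 3 := by
    have : a ^ 2 ≤ (u / 2) ^ 2 := pow_le_pow_left₀ (by linarith) (by linarith) 2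
    calc K * a ^ 2 * u ≤ K * (u / 2) ^ 2 * u := by gcongr
      _ = _ := by ring
  have h2 : u ≤ u ^ 3 := le_self_pow₀ hu1 (by norm_num)
  have h3 : (K / 4 + 1) * u ^ 3 ≤ (K / 4 + 1) * B ^ 3 + u ^ 4 / 32 := by
    rcases le_total u B with h | h
    · have : (K / 4 + 1) * u ^ 3 ≤ (K / 4 + 1) * B ^ 3 := by gcongr
      have : 0 ≤ u ^ 4 := by positivity
      linarith
    · have : B * u ^ 3 ≤ u * u ^ 3 := by gcongr
      have : 0 ≤ (K / 4 + 1) * B ^ 3 := by positivity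
      have : u * u ^ 3 = u ^ 4 := by ring
      rw [hB] at *
      linarith
  have h4 : u ^ 4 / 32 ≤ u ^ 4 * a / 2 := by nlinarith [show 0 ≤ u ^ 4 by positivity]
  rw [hlog, hx2]
  linarith

theorem exists_cosTransform_upper_bound (hE : 1 ≤ finrank ℝ E) {α : ℝ} (h0 : 0 < α) (hα : α < 2) :
    ∃ δ > 0, ∃ C > 0, ∀ z : E × E,
      cosTransform (fun w => Real.exp (-kineticExponent α w)) z ≤
        C * Real.exp (-δ * (Real.sqrt (‖z.1‖ ^ 2 + ‖z.2‖ ^ 2) + 2) *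
          Real.log (Real.sqrt (‖z.1‖ ^ 2 + ‖z.2‖ ^ 2) + 2)) := by
  obtain ⟨C, hC, K, hK, H⟩ := exists_cosTransform_le_exp (E := E) hE h0 hα
  obtain ⟨M, hM⟩ := exists_tilt_bound hK
  refine ⟨1 / 16, by norm_num, (C + 1) * Real.exp M, by positivity, fun z => ?_⟩
  set x := Real.sqrt (‖z.1‖ ^ 2 + ‖z.2‖ ^ 2) with hx
  have hx0 : 0 ≤ x := Real.sqrt_nonneg _
  have hx2 : x ^ 2 = ‖z.1‖ ^ 2 + ‖z.2‖ ^ 2 := Real.sq_sqrt (by positivity)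
  have hzx : ‖z‖ ≤ x := by
    rw [Prod.norm_def]
    exact max_le (Real.le_sqrt_of_sq_le (by nlinarith [sq_nonneg ‖z.2‖]))
      (Real.le_sqrt_of_sq_le (by nlinarith [sq_nonneg ‖z.1‖]))
  set a := Real.log (x + 2) / 8 with ha
  have ha0 : 0 ≤ a := by
    have := Real.log_nonneg (show (1 : ℝ) ≤ x + 2 by linarith); positivity
  have hp : pairing ((a / x) • z) z = a * x := by
    rw [pairing_smul_left, pairing, real_inner_self_eq_norm_sq, real_inner_self_eq_norm_sq, ← hx2]
    rcases hx0.eq_or_lt with h | h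
    · rw [← h]; simp
    · field_simp
  have hn : ‖(a / x) • z‖ ≤ a := by
    rw [norm_smul, Real.norm_of_nonneg (by positivity)]
    rcases hx0.eq_or_lt with h | h
    · rw [← h]; simpa using ha0
    · rw [div_mul_eq_mul_div, div_le_iff₀ h]; gcongr
  calc _ ≤ C * Real.exp (-pairing ((a / x) • z) z + K * ‖(a / x) • z‖ ^ 2 *
        Real.exp (2 * ‖(a / x) • z‖)) := H _ z
    _ ≤ (C + 1) * Real.exp (-(a * x) + K * a ^ 2 * Real.exp (2 * a)) := by
        rw [hp]; gcongr; linarith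
    _ ≤ (C + 1) * Real.exp (M - (1 / 16) * (x + 2) * Real.log (x + 2)) := by
        gcongr; exact hM x hx0 a ha
    _ = _ := by rw [sub_eq_add_neg, Real.exp_add]; ring_nf

end UpperBound

section JumpTransform

open Set Metric Module

variable {E : Type*} [NormedAddCommGroup E] [InnerProductSpace ℝ E] [MeasurableSpace E]
  [BorelSpace E] [FiniteDimensional ℝ E]

/-- The cosine transform of the jump intensity `g`. -/
noncomputable def jumpTransform (g : ℝ × E → ℝ) (w : E × E) : ℝ :=
  ∫ p, Real.cos (pairing w (kineticJump p)) * g p ∂jumpMeasure E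

/-- The symmetrised average of `f` over jumps of intensity `g`. -/
noncomputable def jumpAverage (g : ℝ × E → ℝ) (f : E × E → ℝ) (z : E × E) : ℝ :=
  ∫ p, (f (z - kineticJump p) + f (z + kineticJump p)) / 2 * g p ∂jumpMeasure E

theorem integrable_cos_pairing_mul {h : E × E → ℝ} (hh : Integrable h) (z : E × E) :
    Integrable fun w => Real.cos (pairing w z) * h w :=
  hh.bdd_mul (c := 1) (Continuous.aestronglyMeasurable (by fun_prop))
    (.of_forall fun w => Real.abs_cos_le_one _)

theorem continuous_cosTransform {h : E × E → ℝ} (hh : Integrable h) :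
    Continuous (cosTransform h) := by
  unfold cosTransform
  refine continuous_of_dominated (bound := fun w => ‖h w‖)
    (fun z => (integrable_cos_pairing_mul hh z).aestronglyMeasurable)
    (fun z => .of_forall fun w => ?_) hh.norm (.of_forall fun w => by fun_prop)
  rw [norm_mul]
  exact mul_le_of_le_one_left (norm_nonneg _) (Real.abs_cos_le_one _)

theorem abs_cosTransform_le {h : E × E → ℝ} (hh : Integrable h) (z : E × E) :
    |cosTransform h z| ≤ ∫ w, ‖h w‖ := by
  rw [← Real.norm_eq_abs]
  refine norm_integral_le_of_norm_le hh.norm (.of_forall fun w => ?_)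
  rw [norm_mul]
  exact mul_le_of_le_one_left (norm_nonneg _) (Real.abs_cos_le_one _)

theorem integrable_cos_mul {g : ℝ × E → ℝ} (hg : Integrable g (jumpMeasure E)) (w : E × E) :
    Integrable (fun p => Real.cos (pairing w (kineticJump p)) * g p) (jumpMeasure E) :=
  hg.bdd_mul (c := 1) (Continuous.aestronglyMeasurable (by fun_prop))
    (.of_forall fun p => Real.abs_cos_le_one _)

theorem continuous_jumpTransform {g : ℝ × E → ℝ} (hg : Integrable g (jumpMeasure E)) :
    Continuous (jumpTransform g) := by
  unfold jumpTransform
  refine continuous_of_dominated (bound := fun p => ‖g p‖)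
    (fun w => (integrable_cos_mul hg w).aestronglyMeasurable)
    (fun w => .of_forall fun p => ?_) hg.norm (.of_forall fun p => by fun_prop)
  rw [norm_mul]
  exact mul_le_of_le_one_left (norm_nonneg _) (Real.abs_cos_le_one _)

theorem norm_jumpTransform_le {g : ℝ × E → ℝ} (hg : Integrable g (jumpMeasure E)) (w : E × E) :
    ‖jumpTransform g w‖ ≤ ∫ p, ‖g p‖ ∂jumpMeasure E := by
  refine norm_integral_le_of_norm_le hg.norm (.of_forall fun p => ?_)
  rw [norm_mul]
  exact mul_le_of_le_one_left (norm_nonneg _) (Real.abs_cos_le_one _)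

theorem integrable_mul_jumpTransform_pow {h : E × E → ℝ} (hh : Integrable h)
    {g : ℝ × E → ℝ} (hg : Integrable g (jumpMeasure E)) (n : ℕ) :
    Integrable fun w => h w * jumpTransform g w ^ n := by
  refine hh.mul_bdd (c := (∫ p, ‖g p‖ ∂jumpMeasure E) ^ n)
    ((continuous_jumpTransform hg).pow n).aestronglyMeasurable (.of_forall fun w => ?_)
  rw [norm_pow]
  exact pow_le_pow_left₀ (norm_nonneg _) (norm_jumpTransform_le hg w) n

theorem cosTransform_mul_jumpTransform {h : E × E → ℝ} (hh : Integrable h)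
    {g : ℝ × E → ℝ} (hg : Integrable g (jumpMeasure E)) (z : E × E) :
    cosTransform (fun w => h w * jumpTransform g w) z = jumpAverage g (cosTransform h) z := by
  have hint : Integrable (Function.uncurry fun (w : E × E) (p : ℝ × E) =>
      Real.cos (pairing w z) * (h w * (Real.cos (pairing w (kineticJump p)) * g p)))
      (volume.prod (jumpMeasure E)) := by
    have : Integrable (fun x : (E × E) × (ℝ × E) =>
        (Real.cos (pairing x.1 z) * Real.cos (pairing x.1 (kineticJump x.2))) * (h x.1 * g x.2))
        (volume.prod (jumpMeasure E)) := by
      refine (hh.mul_prod hg).bdd_mul (c := 1) (Continuous.aestronglyMeasurable (by fun_prop))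
        (.of_forall fun x => ?_)
      rw [norm_mul]
      exact mul_le_one₀ (Real.abs_cos_le_one _) (norm_nonneg _) (Real.abs_cos_le_one _)
    exact this.congr (.of_forall fun x => by simp only [Function.uncurry]; ring)
  have hsum (p : ℝ × E) : ∫ w, Real.cos (pairing w z) *
      (h w * (Real.cos (pairing w (kineticJump p)) * g p)) =
      (cosTransform h (z - kineticJump p) + cosTransform h (z + kineticJump p)) / 2 * g p := by
    rw [cosTransform, cosTransform, ← integral_add (integrable_cos_pairing_mul hh _)
      (integrable_cos_pairing_mul hh _), ← integral_div, ← integral_mul_const]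
    refine integral_congr_ae (.of_forall fun w => ?_)
    simp only [pairing_sub_right, pairing_add_right, Real.cos_sub, Real.cos_add]
    ring
  calc _ = ∫ w, ∫ p, Real.cos (pairing w z) *
        (h w * (Real.cos (pairing w (kineticJump p)) * g p)) ∂jumpMeasure E := by
        simp only [cosTransform, jumpTransform, integral_const_mul]
    _ = _ := by
        rw [integral_integral_swap hint, jumpAverage]
        simp only [hsum]

theorem jumpAverage_nonneg {g f : _} (hg : ∀ p : ℝ × E, 0 ≤ g p) (hf : ∀ z : E × E, 0 ≤ f z)
    (z : E × E) : 0 ≤ jumpAverage g f z :=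
  integral_nonneg fun p =>
    mul_nonneg (div_nonneg (add_nonneg (hf _) (hf _)) zero_le_two) (hg p)

theorem cosTransform_mul_jumpTransform_pow_nonneg {h : E × E → ℝ} (hh : Integrable h)
    (hpos : ∀ z, 0 ≤ cosTransform h z) {g : ℝ × E → ℝ} (hg : Integrable g (jumpMeasure E))
    (hg0 : ∀ p, 0 ≤ g p) (n : ℕ) (z : E × E) :
    0 ≤ cosTransform (fun w => h w * jumpTransform g w ^ n) z := by
  induction n generalizing z with
  | zero => simpa using hpos z
  | succ n ih =>
    simp only [pow_succ, ← mul_assoc]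
    rw [cosTransform_mul_jumpTransform (integrable_mul_jumpTransform_pow hh hg n) hg]
    exact jumpAverage_nonneg hg0 ih z

theorem hasSum_cosTransform_mul_exp {h : E × E → ℝ} (hh : Integrable h)
    {g : ℝ × E → ℝ} (hg : Integrable g (jumpMeasure E)) (z : E × E) :
    HasSum (fun n : ℕ => cosTransform (fun w => h w * jumpTransform g w ^ n) z / n.factorial)
      (cosTransform (fun w => h w * Real.exp (jumpTransform g w)) z) := by
  set Λ := ∫ p, ‖g p‖ ∂jumpMeasure E
  have hexp (x : ℝ) : HasSum (fun n : ℕ => x ^ n / n.factorial) (Real.exp x) := by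
    rw [Real.exp_eq_exp_ℝ]
    exact NormedSpace.expSeries_div_hasSum_exp x
  have := hasSum_integral_of_dominated_convergence (μ := (volume : Measure (E × E)))
    (F := fun (n : ℕ) w => Real.cos (pairing w z) * (h w * jumpTransform g w ^ n) / n.factorial)
    (f := fun w => Real.cos (pairing w z) * (h w * Real.exp (jumpTransform g w)))
    (fun n w => ‖h w‖ * (Λ ^ n / n.factorial)) (fun n => ?_) (fun n => .of_forall fun w => ?_)
    (.of_forall fun w => (hexp Λ).summable.mul_left _) ?_ (.of_forall fun w => ?_)
  · simp only [integral_div] at this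
    exact this
  · exact ((integrable_cos_pairing_mul (integrable_mul_jumpTransform_pow hh hg n)
      z).div_const _).aestronglyMeasurable
  · rw [norm_div, norm_mul, norm_mul, norm_pow, Real.norm_natCast, mul_div_assoc, mul_div_assoc]
    calc _ ≤ 1 * (‖h w‖ * (Λ ^ n / n.factorial)) := by
          gcongr
          · exact Real.abs_cos_le_one _
          · exact norm_jumpTransform_le hg w
      _ = _ := one_mul _
  · simp only [tsum_mul_left]
    exact hh.norm.mul_const _
  · have := ((hexp (jumpTransform g w)).mul_left (h w)).mul_left (Real.cos (pairing w z))
    simpa only [mul_div_assoc] using this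

theorem cosTransform_div_factorial_le {h : E × E → ℝ} (hh : Integrable h)
    (hpos : ∀ z, 0 ≤ cosTransform h z) {g : ℝ × E → ℝ} (hg : Integrable g (jumpMeasure E))
    (hg0 : ∀ p, 0 ≤ g p) (n : ℕ) (z : E × E) :
    cosTransform (fun w => h w * jumpTransform g w ^ n) z / n.factorial ≤
      cosTransform (fun w => h w * Real.exp (jumpTransform g w)) z :=
  le_hasSum (hasSum_cosTransform_mul_exp hh hg z) n fun m _ =>
    div_nonneg (cosTransform_mul_jumpTransform_pow_nonneg hh hpos hg hg0 m z) (by positivity)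

theorem cosTransform_mul_exp_nonneg {h : E × E → ℝ} (hh : Integrable h)
    (hpos : ∀ z, 0 ≤ cosTransform h z) {g : ℝ × E → ℝ} (hg : Integrable g (jumpMeasure E))
    (hg0 : ∀ p, 0 ≤ g p) (z : E × E) :
    0 ≤ cosTransform (fun w => h w * Real.exp (jumpTransform g w)) z := by
  simpa using (div_nonneg (cosTransform_mul_jumpTransform_pow_nonneg hh hpos hg hg0 0 z)
    (by positivity)).trans (cosTransform_div_factorial_le hh hpos hg hg0 0 z)

end JumpTransform

section Positivity

open Set Metric Module Filter Topology

variable {E : Type*} [NormedAddCommGroup E]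

/-- The isotropic Gaussian on `E × E`. -/
noncomputable def gaussianWeight (δ : ℝ) (w : E × E) : ℝ :=
  Real.exp (-δ * (‖w.1‖ ^ 2 + ‖w.2‖ ^ 2))

theorem continuous_gaussianWeight (δ : ℝ) : Continuous (gaussianWeight δ : E × E → ℝ) := by
  unfold gaussianWeight; fun_prop

theorem gaussianWeight_pos (δ : ℝ) (w : E × E) : 0 < gaussianWeight δ w :=
  Real.exp_pos _

variable [InnerProductSpace ℝ E]

theorem one_le_jumpRate {α : ℝ} (h0 : 0 < α) {y : E} (hy : y ≠ 0) (hy1 : ‖y‖ ≤ 1) :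
    1 ≤ jumpRate α y :=
  Real.one_le_rpow_of_pos_of_le_one_of_nonpos (norm_pos_iff.2 hy) hy1
    (by have : (0 : ℝ) ≤ finrank ℝ E := by positivity
        linarith)

/-- The jump rate reduced by one and truncated to `[0, n]`. -/
noncomputable def truncatedRate (α : ℝ) (n : ℕ) (p : ℝ × E) : ℝ :=
  max 0 (min (jumpRate α p.2 - 1) n)

theorem truncatedRate_nonneg (α : ℝ) (n : ℕ) (p : ℝ × E) : 0 ≤ truncatedRate α n p :=
  le_max_left _ _

theorem truncatedRate_le (α : ℝ) (n : ℕ) (p : ℝ × E) : truncatedRate α n p ≤ jumpRate α p.2 :=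
  max_le (jumpRate_nonneg _ _) ((min_le_left _ _).trans (by linarith))

variable [MeasurableSpace E] [BorelSpace E]

theorem measurable_truncatedRate (α : ℝ) (n : ℕ) :
    Measurable (truncatedRate α n : ℝ × E → ℝ) := by
  unfold truncatedRate
  exact measurable_const.max
    ((((measurable_jumpRate α).comp measurable_snd).sub_const 1).min measurable_const)

variable [FiniteDimensional ℝ E]

theorem cosTransform_nonneg_of_tendsto {F : ℕ → E × E → ℝ} {f bound : E × E → ℝ}
    (hF : ∀ n, Measurable (F n)) (hb : Integrable bound) (hle : ∀ n w, ‖F n w‖ ≤ bound w)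
    (hlim : ∀ w, Tendsto (fun n => F n w) atTop (𝓝 (f w)))
    (hpos : ∀ n z, 0 ≤ cosTransform (F n) z) (z : E × E) : 0 ≤ cosTransform f z := by
  refine ge_of_tendsto' (tendsto_integral_of_dominated_convergence bound (fun n => ?_) hb
    (fun n => .of_forall fun w => ?_) (.of_forall fun w => (hlim w).const_mul _))
    (fun n => hpos n z)
  · exact (integrable_cos_pairing_mul (hb.mono' (hF n).aestronglyMeasurable
      (.of_forall (hle n))) z).aestronglyMeasurable
  · rw [norm_mul]
    exact (mul_le_of_le_one_left (norm_nonneg _) (Real.abs_cos_le_one _)).trans (hle n w)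

theorem integral_cexp_neg_mul_sq_norm_add_inner {δ : ℝ} (hδ : 0 < δ) (x : E) :
    ∃ c : ℝ, 0 ≤ c ∧ ∫ v : E, Complex.exp (-(δ : ℂ) * ‖v‖ ^ 2 + Complex.I * ⟪x, v⟫) = c := by
  refine ⟨(π / δ) ^ (finrank ℝ E / 2 : ℝ) * Real.exp (-(‖x‖ ^ 2 / (4 * δ))), by positivity, ?_⟩
  rw [GaussianFourier.integral_cexp_neg_mul_sq_norm_add (by simpa using hδ)]
  push_cast
  rw [Complex.ofReal_cpow (by positivity), Complex.I_sq]
  push_cast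
  congr 2
  ring

theorem gaussian_transform {δ : ℝ} (hδ : 0 < δ) :
    Integrable (gaussianWeight δ : E × E → ℝ) ∧
      ∀ z : E × E, 0 ≤ cosTransform (gaussianWeight δ) z := by
  have hI (x : E) := GaussianFourier.integrable_cexp_neg_mul_sq_norm_add (V := E) (b := (δ : ℂ))
    (by simpa using hδ) Complex.I x
  have hprod (z : E × E) : Integrable fun w : E × E =>
      Complex.exp (-(δ : ℂ) * ‖w.1‖ ^ 2 + Complex.I * ⟪z.1, w.1⟫) *
        Complex.exp (-(δ : ℂ) * ‖w.2‖ ^ 2 + Complex.I * ⟪z.2, w.2⟫) :=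
    (hI z.1).mul_prod (hI z.2)
  have heq (z w : E × E) : Complex.exp (-(δ : ℂ) * ‖w.1‖ ^ 2 + Complex.I * ⟪z.1, w.1⟫) *
        Complex.exp (-(δ : ℂ) * ‖w.2‖ ^ 2 + Complex.I * ⟪z.2, w.2⟫) =
      (gaussianWeight δ w : ℂ) * Complex.exp ((pairing w z : ℝ) * Complex.I) := by
    rw [gaussianWeight, Complex.ofReal_exp, ← Complex.exp_add, ← Complex.exp_add, pairing,
      real_inner_comm w.1, real_inner_comm w.2]
    congr 1
    push_cast
    ring
  have hre (z w : E × E) :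
      ((gaussianWeight δ w : ℂ) * Complex.exp ((pairing w z : ℝ) * Complex.I)).re =
        Real.cos (pairing w z) * gaussianWeight δ w := by
    rw [Complex.re_ofReal_mul, Complex.exp_ofReal_mul_I_re, mul_comm]
  refine ⟨?_, fun z => ?_⟩
  · have := (hprod 0).re
    simp only [heq] at this
    refine this.congr (.of_forall fun w => ?_)
    simp [pairing]
  · obtain ⟨a, ha, ha'⟩ := integral_cexp_neg_mul_sq_norm_add_inner hδ z.1
    obtain ⟨b, hb, hb'⟩ := integral_cexp_neg_mul_sq_norm_add_inner hδ z.2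
    have h1 := integral_prod_mul (μ := (volume : Measure E)) (ν := (volume : Measure E))
      (fun v : E => Complex.exp (-(δ : ℂ) * ‖v‖ ^ 2 + Complex.I * ⟪z.1, v⟫))
      (fun v : E => Complex.exp (-(δ : ℂ) * ‖v‖ ^ 2 + Complex.I * ⟪z.2, v⟫))
    rw [ha', hb', ← Measure.volume_eq_prod] at h1
    have h2 := integral_re (hprod z)
    rw [h1] at h2
    simp only [heq] at h2
    have h3 : cosTransform (gaussianWeight δ) z = a * b := by
      have h4 : RCLike.re ((a : ℂ) * b) = a * b := by
        rw [← Complex.ofReal_mul]; exact Complex.ofReal_re _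
      rw [← h4, ← h2, cosTransform]
      exact integral_congr_ae (.of_forall fun w => (hre z w).symm)
    rw [h3]; positivity

theorem integral_one_sub_cos_mul {g : ℝ × E → ℝ} (hg : Integrable g (jumpMeasure E))
    (w : E × E) : ∫ p, (1 - Real.cos (pairing w (kineticJump p))) * g p ∂jumpMeasure E =
      ∫ p, g p ∂jumpMeasure E - jumpTransform g w := by
  rw [jumpTransform, ← integral_sub hg (integrable_cos_mul hg w)]
  simp only [sub_mul, one_mul]

theorem cosTransform_mul_exp_neg_nonneg {h : E × E → ℝ} (hh : Integrable h)
    (hpos : ∀ z, 0 ≤ cosTransform h z) {g : ℝ × E → ℝ} (hg : Integrable g (jumpMeasure E))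
    (hg0 : ∀ p, 0 ≤ g p) (z : E × E) :
    0 ≤ cosTransform (fun w => h w * Real.exp
      (-∫ p, (1 - Real.cos (pairing w (kineticJump p))) * g p ∂jumpMeasure E)) z := by
  have := mul_nonneg (Real.exp_pos (-∫ p, g p ∂jumpMeasure E)).le
    (cosTransform_mul_exp_nonneg hh hpos hg hg0 z)
  rw [cosTransform, ← integral_const_mul] at this
  refine this.trans_eq (integral_congr_ae (.of_forall fun w => ?_))
  simp only [integral_one_sub_cos_mul hg]
  rw [neg_sub, sub_eq_add_neg, Real.exp_add]
  ring

/-- The characteristic exponent obtained by removing the unit intensity from the jump rate. -/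
noncomputable def residualExponent (α : ℝ) (w : E × E) : ℝ :=
  kineticExponent α w - ∫ p, (1 - Real.cos (pairing w (kineticJump p))) * 1 ∂jumpMeasure E

theorem residualExponent_eq (α : ℝ) (w : E × E) : residualExponent α w =
    kineticExponent α w - (jumpMeasure E).real univ + jumpTransform (fun _ => 1) w := by
  rw [residualExponent, integral_one_sub_cos_mul (integrable_const 1)]
  simp only [integral_const, smul_eq_mul, mul_one]
  ring

theorem residualExponent_eq_integral (hE : 1 ≤ finrank ℝ E) {α : ℝ} (hα : α < 2) (w : E × E) :
    residualExponent α w = ∫ p, (1 - Real.cos (pairing w (kineticJump p))) *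
      (jumpRate α p.2 - 1) ∂jumpMeasure E := by
  rw [residualExponent, kineticExponent, ← integral_sub
    (integrable_one_sub_cos_mul_jumpRate hE hα w)]
  · simp only [mul_sub]
  · exact ((integrable_const 1).sub (integrable_cos_mul (g := fun _ => 1)
      (integrable_const 1) w)).congr (.of_forall fun p => by simp)

theorem measurable_residualExponent (α : ℝ) : Measurable (residualExponent (E := E) α) := by
  have : residualExponent (E := E) α = fun w =>
      kineticExponent α w - (jumpMeasure E).real univ + jumpTransform (fun _ => 1) w :=
    funext (residualExponent_eq α)
  rw [this]
  exact ((measurable_kineticExponent α).sub_const _).add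
    (continuous_jumpTransform (integrable_const 1)).measurable

theorem integrable_exp_neg_residualExponent (hE : 1 ≤ finrank ℝ E) {α : ℝ} (h0 : 0 < α)
    (hα : α < 2) : Integrable fun w : E × E => Real.exp (-residualExponent α w) := by
  refine ((integrable_exp_neg_kineticExponent hE h0 hα).const_mul
    (Real.exp (2 * (jumpMeasure E).real univ))).mono'
    (measurable_residualExponent α).neg.exp.aestronglyMeasurable (.of_forall fun w => ?_)
  rw [Real.norm_of_nonneg (Real.exp_pos _).le, ← Real.exp_add, residualExponent_eq]
  have := norm_jumpTransform_le (E := E) (g := fun _ => 1) (integrable_const 1) w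
  simp only [norm_one, integral_const, smul_eq_mul, mul_one] at this
  gcongr
  linarith [(abs_le.1 this).1]

theorem integrable_truncatedRate (α : ℝ) (n : ℕ) :
    Integrable (truncatedRate α n : ℝ × E → ℝ) (jumpMeasure E) := by
  refine (integrable_const (n : ℝ)).mono' (measurable_truncatedRate α n).aestronglyMeasurable
    (.of_forall fun p => ?_)
  rw [Real.norm_of_nonneg (truncatedRate_nonneg _ _ _)]
  exact max_le (by positivity) (min_le_right _ _)

theorem tendsto_integral_truncatedRate (hE : 1 ≤ finrank ℝ E) {α : ℝ} (h0 : 0 < α) (hα : α < 2)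
    (w : E × E) : Tendsto (fun n => ∫ p, (1 - Real.cos (pairing w (kineticJump p))) *
      truncatedRate α n p ∂jumpMeasure E) atTop (𝓝 (residualExponent α w)) := by
  rw [residualExponent_eq_integral hE hα]
  have hc (p : ℝ × E) : 0 ≤ 1 - Real.cos (pairing w (kineticJump p)) := by
    linarith [Real.cos_le_one (pairing w (kineticJump p))]
  refine tendsto_integral_of_dominated_convergence _ (fun n => ?_)
    (integrable_one_sub_cos_mul_jumpRate hE hα w) (fun n => .of_forall fun p => ?_) ?_
  · refine (Measurable.mul ?_ (measurable_truncatedRate α n)).aestronglyMeasurable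
    exact Continuous.measurable (by fun_prop)
  · rw [Real.norm_of_nonneg (mul_nonneg (hc p) (truncatedRate_nonneg _ _ _))]
    exact mul_le_mul_of_nonneg_left (truncatedRate_le _ _ _) (hc p)
  · filter_upwards [ae_jumpMeasure] with p hp
    refine tendsto_const_nhds.congr' ?_
    filter_upwards [eventually_ge_atTop ⌈jumpRate α p.2⌉₊] with n hn
    by_cases hy : p.2 = 0
    · simp [pairing, kineticJump, hy]
    · rw [truncatedRate, min_eq_left, max_eq_right]
      · linarith [one_le_jumpRate h0 hy hp.2]
      · linarith [Nat.ceil_le.1 hn]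

theorem cosTransform_exp_neg_residualExponent_nonneg (hE : 1 ≤ finrank ℝ E) {α : ℝ} (h0 : 0 < α)
    (hα : α < 2) (z : E × E) :
    0 ≤ cosTransform (fun w => Real.exp (-residualExponent α w)) z := by
  have hgauss {δ : ℝ} (hδ : 0 < δ) (z : E × E) :
      0 ≤ cosTransform (fun w => gaussianWeight δ w * Real.exp (-residualExponent α w)) z := by
    obtain ⟨hI, hpos⟩ := gaussian_transform (E := E) hδ
    refine cosTransform_nonneg_of_tendsto (F := fun n w => gaussianWeight δ w * Real.exp
      (-∫ p, (1 - Real.cos (pairing w (kineticJump p))) * truncatedRate α n p ∂jumpMeasure E))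
      (fun n => ?_) hI (fun n w => ?_) (fun w => ?_) (fun n z => ?_) z
    · simp only [integral_one_sub_cos_mul (integrable_truncatedRate α n)]
      have := continuous_jumpTransform (E := E) (integrable_truncatedRate α n)
      have h2 := continuous_gaussianWeight (E := E) δ
      exact Continuous.measurable (by fun_prop)
    · rw [Real.norm_of_nonneg (mul_nonneg (gaussianWeight_pos _ _).le (Real.exp_pos _).le)]
      refine mul_le_of_le_one_right (Real.exp_pos _).le (Real.exp_le_one_iff.2 ?_)
      exact neg_nonpos.2 (integral_nonneg fun p =>
        mul_nonneg (by linarith [Real.cos_le_one (pairing w (kineticJump p))])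
          (truncatedRate_nonneg _ _ _))
    · exact ((tendsto_integral_truncatedRate hE h0 hα w).neg.rexp).const_mul _
    · exact cosTransform_mul_exp_neg_nonneg hI hpos (integrable_truncatedRate α n)
        (truncatedRate_nonneg α n) z
  refine cosTransform_nonneg_of_tendsto (F := fun (n : ℕ) w =>
      gaussianWeight (1 / ((n : ℝ) + 1)) w * Real.exp (-residualExponent α w))
    (fun n => (continuous_gaussianWeight _).measurable.mul
      (measurable_residualExponent α).neg.exp) (integrable_exp_neg_residualExponent hE h0 hα)
    (fun n w => ?_) (fun w => ?_) (fun n z => hgauss (by positivity) z) z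
  · rw [Real.norm_of_nonneg (mul_nonneg (gaussianWeight_pos _ _).le (Real.exp_pos _).le)]
    refine mul_le_of_le_one_left (Real.exp_pos _).le (Real.exp_le_one_iff.2 ?_)
    rw [neg_mul]
    exact neg_nonpos.2 (by positivity)
  · have : Tendsto (fun n : ℕ => gaussianWeight (1 / ((n : ℝ) + 1)) w) atTop (𝓝 1) := by
      have h := ((tendsto_one_div_add_atTop_nhds_zero_nat (𝕜 := ℝ)).neg.mul_const
        (‖w.1‖ ^ 2 + ‖w.2‖ ^ 2)).rexp
      simpa [gaussianWeight] using h
    simpa using this.mul_const (Real.exp (-residualExponent α w))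

theorem cosTransform_exp_neg_residualExponent_zero_pos (hE : 1 ≤ finrank ℝ E) {α : ℝ}
    (h0 : 0 < α) (hα : α < 2) :
    0 < cosTransform (fun w : E × E => Real.exp (-residualExponent α w)) 0 := by
  have : cosTransform (fun w : E × E => Real.exp (-residualExponent α w)) 0 =
      ∫ w : E × E, Real.exp (-residualExponent α w) := by
    simp [cosTransform, pairing]
  rw [this]
  exact integral_exp_pos (integrable_exp_neg_residualExponent hE h0 hα)

end Positivity

section LowerBound

open Set Metric Module Filter Topology

theorem exists_factorial_lower_bound {b : ℝ} (hb : 0 < b) (D : ℕ) :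
    ∃ δ > 0, ∀ x : ℝ, 0 ≤ x → ∀ n : ℕ, 1 ≤ n → (n : ℝ) ≤ 8 * (x + 2) →
      Real.exp (-δ * (x + 2) * Real.log (x + 2)) ≤ (b * (1 / n) ^ D) ^ n / n.factorial := by
  set β := max 0 (-Real.log b)
  have hβ : 0 ≤ β := le_max_left _ _
  refine ⟨8 * (2 * β + 4 * (D + 1)), by positivity, fun x hx n hn hnx => ?_⟩
  have hn0 : (0 : ℝ) < n := by exact_mod_cast hn
  have hL2 : 1 / 2 ≤ Real.log (x + 2) := by
    have := Real.log_le_log (by norm_num) (show (2 : ℝ) ≤ x + 2 by linarith)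
    linarith [Real.log_two_gt_d9]
  have hLn : Real.log n ≤ 4 * Real.log (x + 2) := by
    have h1 : (n : ℝ) ≤ (x + 2) ^ 4 := by
      nlinarith [pow_le_pow_left₀ zero_le_two (show 2 ≤ x + 2 by linarith) 3]
    have := Real.log_le_log hn0 h1
    rwa [Real.log_pow] at this
  have hlb : -Real.log b ≤ 2 * β * Real.log (x + 2) := by
    have : -Real.log b ≤ β := le_max_right _ _
    nlinarith
  have hpos : 0 < (b * (1 / n) ^ D) ^ n / (n : ℝ) ^ n := by positivity
  have hfac : ((n.factorial : ℕ) : ℝ) ≤ (n : ℝ) ^ n := by exact_mod_cast Nat.factorial_le_pow n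
  calc Real.exp (-(8 * (2 * β + 4 * (D + 1))) * (x + 2) * Real.log (x + 2))
      ≤ Real.exp (Real.log ((b * (1 / n) ^ D) ^ n / (n : ℝ) ^ n)) := by
        refine Real.exp_le_exp.2 ?_
        rw [Real.log_div (by positivity) (by positivity), Real.log_pow, Real.log_pow,
          Real.log_mul hb.ne' (by positivity), Real.log_pow, one_div, Real.log_inv]
        set L := Real.log (x + 2)
        have hstep : -Real.log b + (D + 1) * Real.log n ≤ (2 * β + 4 * (D + 1)) * L := by
          have : (D + 1) * Real.log n ≤ (D + 1) * (4 * L) :=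
            mul_le_mul_of_nonneg_left hLn (by positivity)
          linarith
        have hnn : 0 ≤ (2 * β + 4 * (D + 1)) * L :=
          mul_nonneg (by positivity) (by linarith)
        have := mul_le_mul_of_nonneg_left hstep hn0.le
        have := mul_le_mul_of_nonneg_right hnx hnn
        linarith
    _ = (b * (1 / n) ^ D) ^ n / (n : ℝ) ^ n := Real.exp_log hpos
    _ ≤ _ := by gcongr

variable {E : Type*} [NormedAddCommGroup E] [InnerProductSpace ℝ E]

theorem dist_kineticJump_lt {δ : ℝ} {p₀ p : ℝ × E} (hδ : 0 < δ) (hp₀ : ‖p₀.2‖ ≤ 1 / 2)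
    (hp : p.1 ∈ Ioc (0 : ℝ) 1) (h1 : |p.1 - p₀.1| ≤ δ / 2) (h2 : ‖p.2 - p₀.2‖ < δ / 2) :
    dist (kineticJump p) (kineticJump p₀) < δ := by
  rw [Prod.dist_eq, dist_eq_norm, dist_eq_norm]
  refine max_lt ?_ (by simpa [kineticJump] using h2.trans (by linarith))
  have : p.1 • p.2 - p₀.1 • p₀.2 = p.1 • (p.2 - p₀.2) + (p.1 - p₀.1) • p₀.2 := by module
  simp only [kineticJump]
  rw [this]
  refine (norm_add_le _ _).trans_lt ?_
  rw [norm_smul, norm_smul, Real.norm_eq_abs, Real.norm_eq_abs, abs_of_pos hp.1]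
  have h3 : p.1 * ‖p.2 - p₀.2‖ ≤ 1 * ‖p.2 - p₀.2‖ := by gcongr; exact hp.2
  have h4 : |p.1 - p₀.1| * ‖p₀.2‖ ≤ δ / 2 * (1 / 2) := by gcongr
  linarith

variable [MeasurableSpace E] [BorelSpace E] [FiniteDimensional ℝ E]

/-- Lower bound for the mass of jumps within distance `δ` of a given one. -/
noncomputable def jumpMass (E : Type*) [NormedAddCommGroup E] [InnerProductSpace ℝ E]
    [MeasurableSpace E] [BorelSpace E] [FiniteDimensional ℝ E] (δ : ℝ) : ℝ :=
  volume.real (ball (0 : E) 1) / 2 * (δ / 2) ^ (finrank ℝ E + 1)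

theorem measureReal_jumpMeasure_prod {δ a : ℝ} (hδ : 0 < δ) (hδ1 : δ ≤ 1) {y₀ : E}
    (hy₀ : ‖y₀‖ ≤ 1 / 2) (ha : Ioo a (a + δ / 2) ⊆ Ioc 0 1) :
    (jumpMeasure E).real (Ioo a (a + δ / 2) ×ˢ ball y₀ (δ / 2)) / 2 = jumpMass E δ := by
  have hb : ball y₀ (δ / 2) ⊆ closedBall 0 1 := fun y hy => by
    rw [mem_ball, dist_eq_norm] at hy
    rw [mem_closedBall_zero_iff]
    linarith [norm_le_norm_add_norm_sub' y y₀]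
  have hball : volume.real (ball y₀ (δ / 2)) =
      (δ / 2) ^ finrank ℝ E * volume.real (ball (0 : E) 1) := by
    rw [measureReal_def, Measure.addHaar_ball_of_pos _ _ (by positivity), ENNReal.toReal_mul,
      ENNReal.toReal_ofReal (by positivity), measureReal_def]
  rw [jumpMeasure_eq_restrict, measureReal_restrict_apply (measurableSet_Ioo.prod measurableSet_ball),
    inter_eq_left.2 (prod_mono ha hb), Measure.volume_eq_prod, measureReal_prod_prod, hball,
    Real.volume_real_Ioo_of_le (by linarith), jumpMass]
  ring

theorem le_jumpAverage {f : E × E → ℝ} (hf : Continuous f) {B : ℝ} (hB : ∀ z, |f z| ≤ B)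
    (hf0 : ∀ z, 0 ≤ f z) {δ s₀ a : ℝ} (hδ : 0 < δ) (hδ1 : δ ≤ 1) {y₀ : E}
    (hy₀ : ‖y₀‖ ≤ 1 / 2) (ha : Ioo a (a + δ / 2) ⊆ Ioc 0 1)
    (has : ∀ s ∈ Ioo a (a + δ / 2), |s - s₀| ≤ δ / 2) {c ρ : ℝ} {p : E × E}
    (hc : ∀ z, dist z p < ρ → c ≤ f z) {z : E × E}
    (hz : dist z (p + kineticJump (s₀, y₀)) < ρ - δ) :
    c * jumpMass E δ ≤ jumpAverage (fun _ => 1) f z := by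
  set S := Ioo a (a + δ / 2) ×ˢ ball y₀ (δ / 2)
  have hint : Integrable (fun q => (f (z - kineticJump q) + f (z + kineticJump q)) / 2 * 1)
      (jumpMeasure E) := by
    refine (integrable_const B).mono' (Continuous.aestronglyMeasurable (by fun_prop))
      (.of_forall fun q => ?_)
    rw [mul_one, Real.norm_eq_abs, abs_div, abs_two]
    linarith [abs_add_le (f (z - kineticJump q)) (f (z + kineticJump q)), hB (z - kineticJump q),
      hB (z + kineticJump q)]
  calc c * jumpMass E δ = ∫ q, S.indicator (fun _ => c / 2) q ∂jumpMeasure E := by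
        rw [integral_indicator_const _ (measurableSet_Ioo.prod measurableSet_ball),
          ← measureReal_jumpMeasure_prod hδ hδ1 hy₀ ha, smul_eq_mul]
        ring
    _ ≤ _ := by
        refine integral_mono ((integrable_const _).indicator
          (measurableSet_Ioo.prod measurableSet_ball)) hint fun q => ?_
        by_cases hq : q ∈ S
        · rw [indicator_of_mem hq]
          have h1 := dist_kineticJump_lt (p₀ := (s₀, y₀)) hδ hy₀ (ha hq.1) (has _ hq.1)
            (by simpa [dist_eq_norm] using hq.2)
          have h2 : dist (z - kineticJump q) p < ρ := by
            have h3 : z - kineticJump q - p = (z - (p + kineticJump (s₀, y₀))) -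
                (kineticJump q - kineticJump (s₀, y₀)) := by abel
            rw [dist_eq_norm] at h1 hz ⊢
            rw [h3]
            linarith [norm_sub_le (z - (p + kineticJump (s₀, y₀)))
              (kineticJump q - kineticJump (s₀, y₀))]
          linarith [hc _ h2, hf0 (z + kineticJump q)]
        · rw [indicator_of_notMem hq]
          linarith [hf0 (z - kineticJump q), hf0 (z + kineticJump q)]

theorem le_iterate_jumpAverage {f : ℕ → E × E → ℝ} (hf : ∀ k, Continuous (f k))
    (hB : ∀ k, ∃ B, ∀ z, |f k z| ≤ B) (hf0 : ∀ k z, 0 ≤ f k z)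
    (hstep : ∀ k z, f (k + 1) z = jumpAverage (fun _ => 1) (f k) z)
    {δ s₀ a : ℝ} (hδ : 0 < δ) (hδ1 : δ ≤ 1) {y₀ : E}
    (hy₀ : ‖y₀‖ ≤ 1 / 2) (ha : Ioo a (a + δ / 2) ⊆ Ioc 0 1)
    (has : ∀ s ∈ Ioo a (a + δ / 2), |s - s₀| ≤ δ / 2) {k : ℕ} {c ρ : ℝ} {p : E × E}
    (hc : ∀ z, dist z p < ρ → c ≤ f k z) (m : ℕ) (z : E × E)
    (hz : dist z (p + (m : ℝ) • kineticJump (s₀, y₀)) < ρ - m * δ) :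
    c * jumpMass E δ ^ m ≤ f (k + m) z := by
  induction m generalizing z with
  | zero => simpa using hc z (by simpa using hz)
  | succ m ih =>
    obtain ⟨B, hB⟩ := hB (k + m)
    rw [← add_assoc, hstep, pow_succ, ← mul_assoc]
    refine le_jumpAverage (hf _) hB (hf0 _) hδ hδ1 hy₀ ha has ih ?_
    push_cast at hz
    rw [add_smul, one_smul, ← add_assoc] at hz
    linarith

theorem exists_cosTransform_lower_bound (hE : 1 ≤ finrank ℝ E) {α : ℝ} (h0 : 0 < α)
    (hα : α < 2) : ∃ δ > 0, ∃ C > 0, ∀ z : E × E,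
      C * Real.exp (-δ * (Real.sqrt (‖z.1‖ ^ 2 + ‖z.2‖ ^ 2) + 2) *
        Real.log (Real.sqrt (‖z.1‖ ^ 2 + ‖z.2‖ ^ 2) + 2)) ≤
      cosTransform (fun w => Real.exp (-kineticExponent α w)) z := by
  have : Nontrivial E := Module.nontrivial_of_finrank_pos (R := ℝ) (by omega)
  set h : E × E → ℝ := fun w => Real.exp (-residualExponent α w)
  have hh : Integrable h := integrable_exp_neg_residualExponent hE h0 hα
  have hpos : ∀ z, 0 ≤ cosTransform h z := cosTransform_exp_neg_residualExponent_nonneg hE h0 hα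
  have hone : Integrable (fun _ : ℝ × E => (1 : ℝ)) (jumpMeasure E) := integrable_const 1
  set f : ℕ → E × E → ℝ := fun k => cosTransform fun w => h w * jumpTransform (fun _ => 1) w ^ k
  have hfi (k : ℕ) := integrable_mul_jumpTransform_pow hh hone k
  have hfstep (k : ℕ) (z : E × E) : f (k + 1) z = jumpAverage (fun _ => 1) (f k) z := by
    rw [← cosTransform_mul_jumpTransform (hfi k) hone]
    simp only [f, pow_succ, mul_assoc]
  obtain ⟨c, hc, r, hr, hr1, hball⟩ : ∃ c > 0, ∃ r > 0, r ≤ 1 ∧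
      ∀ z : E × E, dist z 0 < r → c ≤ f 0 z := by
    have hf0 : f 0 = cosTransform h := by simp [f]
    have h00 : 0 < cosTransform h 0 := cosTransform_exp_neg_residualExponent_zero_pos hE h0 hα
    obtain ⟨r, hr, H⟩ := Metric.eventually_nhds_iff.1
      ((continuous_cosTransform hh).continuousAt.eventually_const_le (half_lt_self h00))
    refine ⟨_, half_pos h00, min r 1, by positivity, min_le_right _ _, fun z hz => ?_⟩
    rw [hf0]
    exact H (hz.trans_le (min_le_left _ _))
  have hv : 0 < volume.real (ball (0 : E) 1) :=
    ENNReal.toReal_pos (measure_ball_pos _ _ one_pos).ne' measure_ball_lt_top.ne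
  obtain ⟨δ₀, hδ₀, hnum⟩ := exists_factorial_lower_bound
    (b := volume.real (ball (0 : E) 1) / 2 * (r / 4) ^ (finrank ℝ E + 1)) (by positivity)
    (finrank ℝ E + 1)
  refine ⟨δ₀, hδ₀, Real.exp (-(jumpMeasure E).real univ) * c, by positivity, fun z => ?_⟩
  set x := Real.sqrt (‖z.1‖ ^ 2 + ‖z.2‖ ^ 2)
  have hx : 0 ≤ x := Real.sqrt_nonneg _
  have hx1 : ‖z.1‖ ≤ x := Real.le_sqrt_of_sq_le (by linarith [sq_nonneg ‖z.2‖])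
  have hx2 : ‖z.2‖ ≤ x := Real.le_sqrt_of_sq_le (by linarith [sq_nonneg ‖z.1‖])
  set m := ⌈4 * x⌉₊ + 1
  have hmx : 4 * x + 1 ≤ m := by
    have := Nat.le_ceil (4 * x)
    push_cast [m]; linarith
  have hmx' : (m : ℝ) ≤ 4 * x + 2 := by
    have := (Nat.ceil_lt_add_one (show 0 ≤ 4 * x by positivity)).le
    push_cast [m]; linarith
  have hm0 : (0 : ℝ) < m := by linarith
  set δ := r / (4 * m)
  have hδ : 0 < δ := by positivity
  have hδ1 : δ ≤ 1 := (div_le_one (by positivity)).2 (by linarith)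
  have hmδ : m * δ = r / 4 := by simp only [δ]; field_simp
  have hnorm {y : E} (hy : ‖y‖ ≤ 2 * x) : ‖(1 / (m : ℝ)) • y‖ ≤ 1 / 2 := by
    rw [norm_smul, Real.norm_of_nonneg (by positivity), one_div_mul_eq_div, div_le_iff₀ hm0]
    linarith
  have hcont (k : ℕ) : Continuous (f k) := continuous_cosTransform (hfi k)
  have hbdd (k : ℕ) : ∃ B, ∀ z, |f k z| ≤ B := ⟨_, abs_cosTransform_le (hfi k)⟩
  have hfpos (k : ℕ) (z : E × E) : 0 ≤ f k z :=
    cosTransform_mul_jumpTransform_pow_nonneg hh hpos hone (fun _ => zero_le_one) k z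
  have hfirst := le_iterate_jumpAverage hcont hbdd hfpos hfstep (s₀ := 1) (a := 1 - δ / 2) hδ hδ1
    (hnorm (y := z.1) (by linarith)) (fun s hs => ⟨by linarith [hs.1], by linarith [hs.2]⟩)
    (fun s hs => abs_le.2 ⟨by linarith [hs.1], by linarith [hs.2]⟩) hball m
  have hsecond := le_iterate_jumpAverage hcont hbdd hfpos hfstep (s₀ := 0) (a := 0) hδ hδ1
    (hnorm (y := z.2 - z.1) (by linarith [norm_sub_le z.2 z.1]))
    (fun s hs => ⟨by linarith [hs.1], by linarith [hs.2]⟩)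
    (fun s hs => abs_le.2 ⟨by linarith [hs.1], by linarith [hs.2]⟩) hfirst m z (by
      have : (0 : E × E) + (m : ℝ) • kineticJump (1, (1 / (m : ℝ)) • z.1) +
          (m : ℝ) • kineticJump (0, (1 / (m : ℝ)) • (z.2 - z.1)) = z := by
        ext <;> simp [kineticJump, smul_smul, hm0.ne']
      rw [this, dist_self, hmδ]
      linarith)
  have hmass : jumpMass E δ = volume.real (ball (0 : E) 1) / 2 * (r / 4) ^ (finrank ℝ E + 1) *
      (1 / ((m + m : ℕ) : ℝ)) ^ (finrank ℝ E + 1) := by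
    rw [jumpMass, mul_assoc _ ((r / 4) ^ _), ← mul_pow]
    congr 2
    simp only [δ]
    push_cast
    field_simp
    ring
  have hexp : cosTransform (fun w => Real.exp (-kineticExponent α w)) z =
      Real.exp (-(jumpMeasure E).real univ) *
        cosTransform (fun w => h w * Real.exp (jumpTransform (fun _ => 1) w)) z := by
    rw [cosTransform, cosTransform, ← integral_const_mul]
    refine integral_congr_ae (.of_forall fun w => ?_)
    have : -kineticExponent α w = -(jumpMeasure E).real univ +
        (-residualExponent α w + jumpTransform (fun _ => 1) w) := by
      rw [residualExponent_eq]; ring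
    simp only [this, Real.exp_add, h]
    ring
  rw [hexp, mul_assoc]
  refine mul_le_mul_of_nonneg_left ?_ (Real.exp_pos _).le
  refine le_trans ?_ (cosTransform_div_factorial_le hh hpos hone (fun _ => zero_le_one) (m + m) z)
  refine le_trans (mul_le_mul_of_nonneg_left (hnum x hx (m + m) (by omega)
    (by push_cast; linarith)) hc.le) ?_
  rw [zero_add, mul_assoc, ← pow_add, hmass] at hsecond
  rw [← mul_div_assoc]
  gcongr

end LowerBound

/-- sharp two-sided estimate for the density of the small-jump part. -/
theorem stmt_15 (d : ℕ) (hd : 1 ≤ d) (α : ℝ) (hα : α ∈ Set.Ioo (0 : ℝ) 2) :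
    ∃ δ₀ > (0 : ℝ), ∃ δ₁ > (0 : ℝ), ∃ C₀ > (0 : ℝ), ∃ C₁ > (0 : ℝ),
      ∀ z : EuclideanSpace ℝ (Fin d) × EuclideanSpace ℝ (Fin d),
        C₀ * Real.exp (-δ₀ * (Real.sqrt (‖z.1‖ ^ 2 + ‖z.2‖ ^ 2) + 2) *
            Real.log (Real.sqrt (‖z.1‖ ^ 2 + ‖z.2‖ ^ 2) + 2)) ≤ qker d α z ∧
        qker d α z ≤
          C₁ * Real.exp (-δ₁ * (Real.sqrt (‖z.1‖ ^ 2 + ‖z.2‖ ^ 2) + 2) *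
            Real.log (Real.sqrt (‖z.1‖ ^ 2 + ‖z.2‖ ^ 2) + 2)) := by
  obtain ⟨h0, h2⟩ := hα
  have hE : Module.finrank ℝ (EuclideanSpace ℝ (Fin d)) = d := finrank_euclideanSpace_fin
  have hE1 : 1 ≤ Module.finrank ℝ (EuclideanSpace ℝ (Fin d)) := hE.symm ▸ hd
  have hpsi (ζ : EuclideanSpace ℝ (Fin d)) : psi0 d α ζ = stableExponent α ζ := by
    have : {y : EuclideanSpace ℝ (Fin d) | ‖y‖ ≤ 1} = Metric.closedBall 0 1 := by
      ext y; simp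
    rw [psi0, stableExponent, this]
    simp only [jumpRate, hE]
  have hphi (w : EuclideanSpace ℝ (Fin d) × EuclideanSpace ℝ (Fin d)) :
      phi0 d α w = kineticExponent α w := by
    rw [phi0, kineticExponent_eq_integral hE1 h2, intervalIntegral.integral_of_le zero_le_one]
    simp only [hpsi]
  have hq (z : EuclideanSpace ℝ (Fin d) × EuclideanSpace ℝ (Fin d)) :
      qker d α z = (2 * π) ^ (-(2 * (d : ℝ))) *
        cosTransform (fun w => Real.exp (-kineticExponent α w)) z := by
    simp only [qker, hphi, cosTransform, pairing]
  have hπ : 0 < (2 * π) ^ (-(2 * (d : ℝ))) := by positivity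
  obtain ⟨δ₀, hδ₀, C₀, hC₀, hlower⟩ := exists_cosTransform_lower_bound hE1 h0 h2
  obtain ⟨δ₁, hδ₁, C₁, hC₁, hupper⟩ := exists_cosTransform_upper_bound hE1 h0 h2
  refine ⟨δ₀, hδ₀, δ₁, hδ₁, _, mul_pos hπ hC₀, _, mul_pos hπ hC₁, fun z => ?_⟩
  rw [hq, mul_assoc _ C₀, mul_assoc _ C₁]
  exact ⟨mul_le_mul_of_nonneg_left (hlower z) hπ.le, mul_le_mul_of_nonneg_left (hupper z) hπ.le⟩
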